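/- arXiv:1604.03594 — 3 statements merged into one kernel-verified Lean document; each statement's English description precedes it below -/
import Mathlib

section
/- Let R be a factorial domain, K a field of quotients of R, X an indeterminate over K, f ∈ R[X] nonzero, and L a quotient group of [[f]]. For g ∈ [[f]] set P_g = gK[X] ∩ [[f]]. Then: (1) (P_g P_h)_v = P_{gh} for all g, h ∈ [[f]]; (2) if g ∈ [[f]] ∩ 𝒜(K[X]), then v_{P_g}(x[[f]]) = v_g(x) for all x ∈ L, where v_g denotes the exponent of g in the factorization in K[X]; (3) if g ∈ [[f]], Q ∈ 𝔛([[f]]) and q ∈ Q ∩ 𝒜(R), then v_Q(g[[f]]) ≤ v_q(e_f(g)). -/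
open Pointwise Polynomial

namespace IVP

/-! ### Generic monoid-theoretic notions -/

section Generic

variable {M : Type*} [CommMonoid M]

/-- `u` is a unit of the (sub)monoid given by the subset `S`. -/
def IsMUnit (S : Set M) (u : M) : Prop := u ∈ S ∧ ∃ v ∈ S, u * v = 1

/-- divisibility within the (sub)monoid given by the subset `S`. -/
def MDvd (S : Set M) (x y : M) : Prop := ∃ c ∈ S, y = x * c

/-- `x` and `y` are associated in the (sub)monoid given by the subset `S`. -/
def MAssoc (S : Set M) (x y : M) : Prop := ∃ ε, IsMUnit S ε ∧ y = x * ε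

/-- `u` is an atom (irreducible element) of the (sub)monoid given by `S`. -/
def IsMAtom (S : Set M) (u : M) : Prop :=
  u ∈ S ∧ ¬ IsMUnit S u ∧ ∀ x ∈ S, ∀ y ∈ S, u = x * y → IsMUnit S x ∨ IsMUnit S y

/-- `p` is a prime element of the (sub)monoid given by `S`. -/
def IsMPrime (S : Set M) (p : M) : Prop :=
  p ∈ S ∧ ¬ IsMUnit S p ∧ ∀ a ∈ S, ∀ b ∈ S, MDvd S p (a * b) → MDvd S p a ∨ MDvd S p b

/-- `I` is an `s`-ideal of the (sub)monoid given by `S`. -/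
def IsSIdeal (S I : Set M) : Prop := I ⊆ S ∧ ∀ a ∈ I, ∀ h ∈ S, a * h ∈ I

/-- `I` is a prime `s`-ideal of the (sub)monoid given by `S`. -/
def IsPrimeSIdeal (S I : Set M) : Prop :=
  IsSIdeal S I ∧ ∀ a ∈ S, ∀ b ∈ S, a * b ∈ I → a ∈ I ∨ b ∈ I

/-- `I` is a height-one prime `s`-ideal (a minimal nonempty prime `s`-ideal) of `S`. -/
def IsHeightOnePrime (S I : Set M) : Prop :=
  IsPrimeSIdeal S I ∧ I.Nonempty ∧
    ∀ J : Set M, IsPrimeSIdeal S J → J.Nonempty → J ⊆ I → J = I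

/-- `T` is a divisor-closed submonoid of the (sub)monoid given by `S`. -/
def IsDivisorClosed (S T : Set M) : Prop :=
  T ⊆ S ∧ 1 ∈ T ∧ (∀ x ∈ T, ∀ y ∈ T, x * y ∈ T) ∧ ∀ x ∈ S, ∀ y ∈ S, x * y ∈ T → x ∈ T

/-- the (sub)monoid given by `S` is factorial: every non-unit is a product of primes. -/
def IsFactorialSet (S : Set M) : Prop :=
  ∀ x ∈ S, ¬ IsMUnit S x → ∃ l : List M, (∀ p ∈ l, IsMPrime S p) ∧ x = l.prod

/-- `X⁻¹ = {z ∣ z X ⊆ S}`, computed in an ambient monoid containing the quotients. -/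
def setInv (S X : Set M) : Set M := {z | ∀ x ∈ X, z * x ∈ S}

/-- the divisorial closure `X_v = (X⁻¹)⁻¹` relative to the (sub)monoid given by `S`. -/
def vcl (S X : Set M) : Set M := setInv S (setInv S X)

/-- `I` is a divisorial ideal (`v`-ideal) of the (sub)monoid given by `S`. -/
def IsVIdeal (S I : Set M) : Prop := I ⊆ S ∧ vcl S I = I

/-- `I` is a principal (`s`-)ideal of the (sub)monoid given by `S`. -/
def IsPrincipalIdl (S I : Set M) : Prop := ∃ a ∈ S, I = {a} * S

/-- the `P`-adic exponent of an ideal `I`, via `v_P(I) ≥ n ↔ I ⊆ (Pⁿ)_v`. -/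
noncomputable def vexp (S P I : Set M) : ℕ := sSup {n : ℕ | I ⊆ vcl S (P ^ n)}

/-- the exponent of `g` in `y`, i.e. `sup {n ∣ gⁿ ∣ y}`. -/
noncomputable def expOf (g y : M) : ℕ := sSup {n : ℕ | g ^ n ∣ y}

/-- two ideals lie in the same divisor class iff they differ by a principal factor. -/
def IdlRel (S : Set M) (P Q : Set M) : Prop := ∃ a ∈ S, ∃ b ∈ S, {b} * P = {a} * Q

theorem subset_vcl (S X : Set M) : X ⊆ vcl S X := by
  intro x hx z hz
  rw [mul_comm]
  exact hz x hx

theorem setInv_anti {S X Y : Set M} (h : X ⊆ Y) : setInv S Y ⊆ setInv S X :=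
  fun z hz x hx => hz x (h hx)

theorem vcl_mono {S X Y : Set M} (h : X ⊆ Y) : vcl S X ⊆ vcl S Y :=
  setInv_anti (setInv_anti h)

theorem setInv_vcl (S X : Set M) : setInv S (vcl S X) = setInv S X := by
  apply Set.Subset.antisymm (setInv_anti (subset_vcl S X))
  intro z hz y hy
  rw [mul_comm]
  exact hy z hz

theorem vcl_idem (S X : Set M) : vcl S (vcl S X) = vcl S X := by
  calc vcl S (vcl S X) = setInv S (setInv S (vcl S X)) := rfl
    _ = setInv S (setInv S X) := by rw [setInv_vcl]
    _ = vcl S X := rfl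

theorem hstab_vcl {S X : Set M} (hS : ∀ a ∈ S, ∀ b ∈ S, a * b ∈ S) :
    ∀ z ∈ vcl S X, ∀ h ∈ S, z * h ∈ vcl S X := by
  intro z hz h hh w hw
  have h1 : z * w ∈ S := hz w hw
  have e : z * h * w = z * w * h := mul_right_comm z h w
  rw [e]
  exact hS _ h1 _ hh

theorem bound_vcl {S X : Set M} {c : M} (hc : ∀ x ∈ X, c * x ∈ S) :
    ∀ y ∈ vcl S X, c * y ∈ S := by
  intro y hy
  rw [mul_comm]
  exact hy c hc

theorem mul_subset_vcl_mul (S X Y : Set M) : vcl S X * Y ⊆ vcl S (X * Y) := by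
  rintro _ ⟨a, ha, b, hb, rfl⟩ z hz
  have hzb : ∀ x ∈ X, (z * b) * x ∈ S := by
    intro x hx
    have hxb : x * b ∈ X * Y := Set.mul_mem_mul hx hb
    have h1 := hz _ hxb
    have e : z * b * x = z * (x * b) := by
      rw [mul_assoc, mul_comm b x]
    rw [e]
    exact h1
  have h2 : a * (z * b) ∈ S := ha _ hzb
  have e2 : a * b * z = a * (z * b) := by
    rw [mul_assoc, mul_comm b z]
  rw [e2]
  exact h2

theorem vcl_mul_vcl_left (S X Y : Set M) : vcl S (vcl S X * Y) = vcl S (X * Y) := by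
  apply Set.Subset.antisymm
  · have h1 := vcl_mono (S := S) (mul_subset_vcl_mul S X Y)
    rwa [vcl_idem] at h1
  · exact vcl_mono (Set.mul_subset_mul (subset_vcl S X) subset_rfl)

theorem vcl_mul_vcl_right (S X Y : Set M) : vcl S (X * vcl S Y) = vcl S (X * Y) := by
  rw [mul_comm X, vcl_mul_vcl_left, mul_comm]

theorem coe_mul_self (H : Submonoid M) : (H : Set M) * (H : Set M) = (H : Set M) := by
  apply Set.Subset.antisymm
  · rintro _ ⟨a, ha, b, hb, rfl⟩
    exact mul_mem ha hb
  · intro x hx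
    exact ⟨x, hx, 1, H.one_mem, mul_one x⟩

theorem setInv_coe (H : Submonoid M) : setInv (H : Set M) (H : Set M) = (H : Set M) := by
  apply Set.Subset.antisymm
  · intro z hz
    have h1 := hz 1 H.one_mem
    rwa [mul_one] at h1
  · intro h hh x hx
    exact mul_mem hh hx

theorem vcl_coe (H : Submonoid M) : vcl (H : Set M) (H : Set M) = (H : Set M) := by
  unfold vcl
  rw [setInv_coe, setInv_coe]

theorem coe_mul_eq (H : Submonoid M) {I : Set M} (hI : vcl (H : Set M) I = I) :
    (H : Set M) * I = I := by
  apply Set.Subset.antisymm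
  · rintro _ ⟨h, hh, y, hy, rfl⟩
    show h * y ∈ I
    rw [mul_comm]
    rw [← hI] at hy ⊢
    exact hstab_vcl (fun a ha b hb => mul_mem ha hb) y hy h hh
  · intro x hx
    exact ⟨1, H.one_mem, x, hx, one_mul x⟩

/-- the setoid identifying height-one primes lying in the same divisor class. -/
def primeSetoid (H : Submonoid M) : Setoid {P : Set M // IsHeightOnePrime (H : Set M) P} where
  r P Q := IdlRel (H : Set M) P.1 Q.1
  iseqv := by
    constructor
    · exact fun P => ⟨1, H.one_mem, 1, H.one_mem, rfl⟩
    · rintro P Q ⟨a, ha, b, hb, h⟩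
      exact ⟨b, hb, a, ha, h.symm⟩
    · rintro P Q S ⟨a, ha, b, hb, h1⟩ ⟨a', ha', b', hb', h2⟩
      refine ⟨a * a', mul_mem ha ha', b' * b, mul_mem hb' hb, ?_⟩
      calc ({b' * b} : Set M) * P.1 = {b'} * ({b} * P.1) := by
            rw [← mul_assoc, Set.singleton_mul_singleton]
        _ = {b'} * ({a} * Q.1) := by rw [h1]
        _ = {a} * ({b'} * Q.1) := by
            rw [← mul_assoc, mul_comm ({b'} : Set M) ({a} : Set M), mul_assoc]
        _ = {a} * ({a'} * S.1) := by rw [h2]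
        _ = {a * a'} * S.1 := by rw [← mul_assoc, Set.singleton_mul_singleton]

end Generic

/-! ### Krull monoids -/

section Krull

variable {G : Type*} [CommGroup G]

/-- `H` is completely integrally closed (in its quotient group). -/
def IsCIC (H : Submonoid G) : Prop :=
  ∀ x : G, (∃ c ∈ H, ∀ n : ℕ, c * x ^ n ∈ H) → x ∈ H

/-- `H` is a Mori monoid: the ascending chain condition on divisorial ideals holds. -/
def IsMori (H : Submonoid G) : Prop :=
  ∀ I : ℕ → Set G, (∀ n, (I n).Nonempty ∧ IsVIdeal (H : Set G) (I n)) →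
    (∀ n, I n ⊆ I (n + 1)) → ∃ N, ∀ m, N ≤ m → I m = I N

/-- `H` is a Krull monoid, i.e. a completely integrally closed Mori monoid. -/
def IsKrullMonoid (H : Submonoid G) : Prop := IsCIC H ∧ IsMori H

/-- `H ⊆ T` is a saturated submonoid. -/
def IsSaturated (H T : Submonoid G) : Prop :=
  ∀ x ∈ H, ∀ y ∈ H, (∃ t ∈ T, y = x * t) → ∃ h ∈ H, y = x * h

end Krull

/-! ### The divisor-class group of a submonoid of (the multiplicative monoid of) a field -/

section ClassGrp

variable {F : Type*} [Field F]

/-- `I` is a fractional divisorial ideal of `H`. -/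
def IsFracVIdl (H : Submonoid F) (I : Set F) : Prop :=
  I.Nonempty ∧ (∃ a : F, a ≠ 0 ∧ ∀ x ∈ I, a * x ∈ H) ∧ vcl (H : Set F) I = I

/-- the type of fractional divisorial ideals of `H`. -/
def FIdl (H : Submonoid F) : Type _ := {I : Set F // IsFracVIdl H I}

theorem isFracVIdl_coe (H : Submonoid F) : IsFracVIdl H (H : Set F) :=
  ⟨⟨1, H.one_mem⟩, ⟨1, one_ne_zero, fun x hx => by rwa [one_mul]⟩, vcl_coe H⟩

theorem isFracVIdl_mul {H : Submonoid F} {I J : Set F}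
    (hI : IsFracVIdl H I) (hJ : IsFracVIdl H J) :
    IsFracVIdl H (vcl (H : Set F) (I * J)) := by
  obtain ⟨hne, ⟨a, ha0, ha⟩, hIv⟩ := hI
  obtain ⟨hne', ⟨b, hb0, hb⟩, hJv⟩ := hJ
  refine ⟨(hne.mul hne').mono (subset_vcl _ _), ⟨a * b, mul_ne_zero ha0 hb0, ?_⟩,
    vcl_idem _ _⟩
  intro x hx
  refine bound_vcl ?_ x hx
  rintro _ ⟨u, hu, v, hv, rfl⟩
  have e : a * b * (u * v) = (a * u) * (b * v) := by ring
  rw [e]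
  exact mul_mem (ha u hu) (hb v hv)

instance (H : Submonoid F) : CommMonoid (FIdl H) where
  mul I J := ⟨vcl (H : Set F) (I.1 * J.1), isFracVIdl_mul I.2 J.2⟩
  one := ⟨(H : Set F), isFracVIdl_coe H⟩
  mul_assoc I J K := by
    apply Subtype.ext
    show vcl _ (vcl _ (I.1 * J.1) * K.1) = vcl _ (I.1 * vcl _ (J.1 * K.1))
    rw [vcl_mul_vcl_left, vcl_mul_vcl_right, mul_assoc]
  one_mul I := by
    apply Subtype.ext
    show vcl _ ((H : Set F) * I.1) = I.1
    rw [coe_mul_eq H I.2.2.2, I.2.2.2]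
  mul_one I := by
    apply Subtype.ext
    show vcl _ (I.1 * (H : Set F)) = I.1
    rw [mul_comm, coe_mul_eq H I.2.2.2, I.2.2.2]
  mul_comm I J := by
    apply Subtype.ext
    show vcl _ (I.1 * J.1) = vcl _ (J.1 * I.1)
    rw [mul_comm]

theorem setInv_prin (H : Submonoid F) {a : F} (ha : a ≠ 0) :
    setInv (H : Set F) ({a} * (H : Set F)) = {a⁻¹} * (H : Set F) := by
  apply Set.Subset.antisymm
  · intro z hz
    have h1 : z * (a * 1) ∈ H := hz _ (Set.mul_mem_mul rfl H.one_mem)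
    rw [mul_one] at h1
    refine ⟨a⁻¹, rfl, z * a, h1, ?_⟩
    show a⁻¹ * (z * a) = z
    rw [mul_comm z a, ← mul_assoc, inv_mul_cancel₀ ha, one_mul]
  · rintro _ ⟨s, hs, h, hh, rfl⟩ _ ⟨t, ht, k, hk, rfl⟩
    rw [Set.mem_singleton_iff] at hs ht
    rw [hs, ht]
    have e : a⁻¹ * h * (a * k) = (a⁻¹ * a) * (h * k) := by ring
    rw [e, inv_mul_cancel₀ ha, one_mul]
    exact mul_mem hh hk

theorem isFracVIdl_prin (H : Submonoid F) {a : F} (ha : a ≠ 0) :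
    IsFracVIdl H ({a} * (H : Set F)) := by
  refine ⟨⟨a * 1, Set.mul_mem_mul rfl H.one_mem⟩, ⟨a⁻¹, inv_ne_zero ha, ?_⟩, ?_⟩
  · rintro _ ⟨s, hs, h, hh, rfl⟩
    rw [Set.mem_singleton_iff] at hs
    rw [hs]
    have e : a⁻¹ * (a * h) = (a⁻¹ * a) * h := by ring
    rw [e, inv_mul_cancel₀ ha, one_mul]
    exact hh
  · unfold vcl
    rw [setInv_prin H ha, setInv_prin H (inv_ne_zero ha), inv_inv]

theorem prin_mul_set (H : Submonoid F) (a b : F) :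
    ({a} * (H : Set F)) * ({b} * (H : Set F)) = {a * b} * (H : Set F) := by
  rw [mul_mul_mul_comm, Set.singleton_mul_singleton, coe_mul_self]

/-- the homomorphism sending `a` to the principal fractional ideal `aH`. -/
def prinHom (H : Submonoid F) : Fˣ →* (FIdl H)ˣ where
  toFun a :=
    { val := ⟨{(a : F)} * (H : Set F), isFracVIdl_prin H a.ne_zero⟩
      inv := ⟨{((a⁻¹ : Fˣ) : F)} * (H : Set F), isFracVIdl_prin H a⁻¹.ne_zero⟩
      val_inv := by
        apply Subtype.ext
        show vcl (H : Set F) (({(a : F)} * (H : Set F)) * ({((a⁻¹ : Fˣ) : F)} * (H : Set F)))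
          = (H : Set F)
        rw [prin_mul_set, Units.mul_inv, Set.singleton_one, one_mul, vcl_coe]
      inv_val := by
        apply Subtype.ext
        show vcl (H : Set F) (({((a⁻¹ : Fˣ) : F)} * (H : Set F)) * ({(a : F)} * (H : Set F)))
          = (H : Set F)
        rw [prin_mul_set, Units.inv_mul, Set.singleton_one, one_mul, vcl_coe] }
  map_one' := by
    apply Units.ext
    apply Subtype.ext
    show ({((1 : Fˣ) : F)} : Set F) * (H : Set F) = (H : Set F)
    rw [Units.val_one, Set.singleton_one, one_mul]
  map_mul' a b := by
    apply Units.ext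
    apply Subtype.ext
    show ({((a * b : Fˣ) : F)} : Set F) * (H : Set F)
      = vcl (H : Set F) (({(a : F)} * (H : Set F)) * ({(b : F)} * (H : Set F)))
    rw [prin_mul_set, Units.val_mul,
      (isFracVIdl_prin H (mul_ne_zero a.ne_zero b.ne_zero)).2.2]

/-- the divisor-class group: `v`-invertible fractional `v`-ideals modulo principal ones. -/
def ClassGrp (H : Submonoid F) : Type _ := (FIdl H)ˣ ⧸ (prinHom H).range

instance (H : Submonoid F) : CommGroup (ClassGrp H) :=
  inferInstanceAs (CommGroup ((FIdl H)ˣ ⧸ (prinHom H).range))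

end ClassGrp

/-! ### Integer-valued polynomials over a factorial domain -/

section IntR

variable (R : Type*) [CommRing R] [IsDomain R] [UniqueFactorizationMonoid R]

/-- the quotient field of `R`. -/
abbrev Kq := FractionRing R

/-- the polynomial ring `K[X]` over the quotient field of `R`. -/
abbrev PK := Polynomial (Kq R)

/-- the field of rational functions, containing the quotient group of `Int(R)•`. -/
abbrev FF := FractionRing (PK R)

/-- the constant polynomial given by `r : R`. -/
noncomputable def cpoly (r : R) : PK R := Polynomial.C (algebraMap R (Kq R) r)

/-- the set of integer-valued polynomials: `g ∈ K[X]` with `g(R) ⊆ R`. -/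
def intSet : Set (PK R) :=
  {g | ∀ x : R, ∃ r : R, Polynomial.eval (algebraMap R (Kq R) x) g = algebraMap R (Kq R) r}

/-- the monadic submonoid `[[f]]` of `Int(R)•` generated by `f`. -/
def mon (f : PK R) : Set (PK R) :=
  {g | g ∈ intSet R ∧ g ≠ 0 ∧ ∃ k : ℕ, ∃ h ∈ intSet R, g * h = f ^ k}

/-- the subring `R[X]`: polynomials all of whose coefficients lie in `R`. -/
def rxSet : Set (PK R) :=
  {g | ∀ n : ℕ, ∃ r : R, g.coeff n = algebraMap R (Kq R) r}

/-- the multiplicative monoid `R[X]•`. -/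
def rxnz : Set (PK R) := {g | g ∈ rxSet R ∧ g ≠ 0}

/-- the multiplicative monoid `Int(R)•`. -/
def intnz : Set (PK R) := {g | g ∈ intSet R ∧ g ≠ 0}

/-- `g` is a primitive polynomial in `R[X]`: every common divisor of its coefficients
is a unit of `R`. -/
def IsPrimPoly (g : PK R) : Prop :=
  ∀ r : R, (∀ n : ℕ, ∃ s : R, g.coeff n = algebraMap R (Kq R) (r * s)) → IsUnit r

/-- `d` is an image-content function: `d g` is a greatest common divisor (in `R`)
of the image `g(R)`. -/
def IsImageGcdFun (d : PK R → R) : Prop :=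
  ∀ g ∈ intSet R, g ≠ 0 →
    (∀ x : R, ∃ r : R,
        Polynomial.eval (algebraMap R (Kq R) x) g = algebraMap R (Kq R) (d g * r)) ∧
      ∀ r : R, (∀ x : R, ∃ s : R,
          Polynomial.eval (algebraMap R (Kq R) x) g = algebraMap R (Kq R) (r * s)) →
        r ∣ d g

/-- `e` is a least common multiple in `R` of the set `{d(g·h)/d(h) : h ∈ [[f]]}`,
i.e. `e = e_f(g)` up to associates. -/
def IsEfVal (d : PK R → R) (f g : PK R) (e : R) : Prop :=
  (∀ h ∈ mon R f, d (g * h) ∣ d h * e) ∧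
    ∀ r : R, (∀ h ∈ mon R f, d (g * h) ∣ d h * r) → e ∣ r

theorem intSet_one : (1 : PK R) ∈ intSet R := fun _ => ⟨1, by simp⟩

theorem intSet_mul {g h : PK R} (hg : g ∈ intSet R) (hh : h ∈ intSet R) :
    g * h ∈ intSet R := by
  intro x
  obtain ⟨r, hr⟩ := hg x
  obtain ⟨s, hs⟩ := hh x
  exact ⟨r * s, by rw [Polynomial.eval_mul, hr, hs, map_mul]⟩

theorem mon_one (f : PK R) : (1 : PK R) ∈ mon R f :=
  ⟨intSet_one R, one_ne_zero, 0, 1, intSet_one R, by simp⟩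

theorem mon_mul {f g h : PK R} (hg : g ∈ mon R f) (hh : h ∈ mon R f) :
    g * h ∈ mon R f := by
  obtain ⟨hgI, hg0, k, a, haI, hka⟩ := hg
  obtain ⟨hhI, hh0, l, b, hbI, hlb⟩ := hh
  refine ⟨intSet_mul R hgI hhI, mul_ne_zero hg0 hh0, k + l, a * b, intSet_mul R haI hbI, ?_⟩
  rw [pow_add, ← hka, ← hlb]
  ring

/-- the monadic submonoid `[[f]]`, viewed inside the field of rational functions. -/
noncomputable def Hmon (f : PK R) : Submonoid (FF R) where
  carrier := algebraMap (PK R) (FF R) '' mon R f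
  one_mem' := ⟨1, mon_one R f, map_one _⟩
  mul_mem' := by
    rintro x y ⟨a, ha, rfl⟩ ⟨b, hb, rfl⟩
    exact ⟨a * b, mon_mul R ha hb, map_mul _ _ _⟩

/-- the ideal `gK[X] ∩ [[f]]`, at the level of polynomials. -/
def pIdlP (f g : PK R) : Set (PK R) := {z | z ∈ mon R f ∧ ∃ h : PK R, z = g * h}

/-- the ideal `gK[X] ∩ [[f]]`, inside the field of rational functions. -/
noncomputable def pIdl (f g : PK R) : Set (FF R) := algebraMap (PK R) (FF R) '' pIdlP R f g

end IntR

end IVP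

open IVP Pointwise Polynomial

namespace IVPX

theorem dickson {α ι : Type*} [Finite ι] (ψ : α → ι → ℕ) :
    ∃ T : Set α, T.Finite ∧ ∀ x, ∃ y ∈ T, ψ y ≤ ψ x := by
  classical
  have hpwo : (Set.range ψ).IsPWO := Set.isPWO_of_wellQuasiOrderedLE _
  have hfin : {m | Minimal (· ∈ Set.range ψ) m}.Finite :=
    (setOfPred_minimal_antichain _).finite_of_partiallyWellOrderedOn
      (hpwo.mono (fun m hm => hm.1))
  by_cases hα : Nonempty α
  · choose! g hg using (fun (m : ι → ℕ) (hm : m ∈ Set.range ψ) => hm)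
    refine ⟨g '' {m | Minimal (· ∈ Set.range ψ) m}, hfin.image _, fun x => ?_⟩
    obtain ⟨z, hz, hz'⟩ := hpwo.exists_le_minimal (Set.mem_range_self x)
    exact ⟨g z, ⟨z, hz', rfl⟩, by rw [hg z hz'.1]; exact hz⟩
  · exact ⟨∅, Set.finite_empty, fun x => (hα ⟨x⟩).elim⟩

set_option linter.unusedSectionVars false

section
variable {R : Type*} [CommRing R] [IsDomain R] [UniqueFactorizationMonoid R]

/-- membership in the localization of `R` at `p`. -/
def pInt (p : R) (k : Kq R) : Prop :=
  ∃ r s : R, ¬ p ∣ s ∧ k * algebraMap R (Kq R) s = algebraMap R (Kq R) r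

theorem aminj : Function.Injective (algebraMap R (Kq R)) := IsFractionRing.injective R (Kq R)

theorem am_ne {r : R} (h : r ≠ 0) : algebraMap R (Kq R) r ≠ 0 := by
  rwa [Ne, map_eq_zero_iff _ aminj]

theorem pInt_of {p : R} (hp : Prime p) (r : R) : pInt p (algebraMap R (Kq R) r) :=
  ⟨r, 1, fun h => hp.not_isUnit (isUnit_of_dvd_one h), by simp⟩

theorem pInt_mul {p : R} (hp : Prime p) {k l : Kq R} (hk : pInt p k) (hl : pInt p l) :
    pInt p (k * l) := by
  obtain ⟨r, s, hs, h⟩ := hk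
  obtain ⟨r', s', hs', h'⟩ := hl
  refine ⟨r * r', s * s', fun hd => (hp.dvd_or_dvd hd).elim hs hs', ?_⟩
  rw [map_mul, map_mul, ← h, ← h']; ring

theorem pInt_add {p : R} (hp : Prime p) {k l : Kq R} (hk : pInt p k) (hl : pInt p l) :
    pInt p (k + l) := by
  obtain ⟨r, s, hs, h⟩ := hk
  obtain ⟨r', s', hs', h'⟩ := hl
  refine ⟨r * s' + r' * s, s * s', fun hd => (hp.dvd_or_dvd hd).elim hs hs', ?_⟩
  rw [map_mul, map_add, map_mul, map_mul, ← h, ← h']; ring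

theorem pInt_assoc {p p' : R} (h : Associated p p') {k : Kq R} (hk : pInt p k) : pInt p' k := by
  obtain ⟨r, s, hs, h'⟩ := hk
  exact ⟨r, s, fun hd => hs (h.dvd.trans hd), h'⟩

theorem int_of_pInt {k : Kq R} (h : ∀ p : R, Prime p → pInt p k) :
    ∃ r : R, k = algebraMap R (Kq R) r := by
  obtain ⟨a, b, hab, rfl⟩ := IsFractionRing.exists_reduced_fraction R k
  by_cases hu : IsUnit (b : R)
  · obtain ⟨u, hu⟩ := hu
    refine ⟨a * (↑u⁻¹ : R), ?_⟩
    rw [IsLocalization.mk'_eq_iff_eq_mul, ← map_mul, ← hu, mul_assoc]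
    simp
  · obtain ⟨p, hp, hpb⟩ := WfDvdMonoid.exists_irreducible_factor hu (nonZeroDivisors.ne_zero b.2)
    have hp' : Prime p := hp.prime
    obtain ⟨r, s, hs, h⟩ := h p hp'
    have h2 : a * s = r * b := by
      apply aminj
      rw [map_mul, map_mul, ← h, mul_right_comm, IsLocalization.mk'_spec]
    have h3 : p ∣ a * s := h2 ▸ hpb.mul_left r
    rcases hp'.dvd_or_dvd h3 with h4 | h4
    · exact (hp.not_isUnit (hab h4 hpb)).elim
    · exact (hs h4).elim

theorem dvd_of_pInt {p a : R} (hp : Prime p)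
    (h : pInt p (algebraMap R (Kq R) a * (algebraMap R (Kq R) p)⁻¹)) : p ∣ a := by
  obtain ⟨r, s, hs, h⟩ := h
  have hp0 := am_ne hp.ne_zero
  have h2 : a * s = r * p := by
    apply aminj
    rw [map_mul, map_mul, ← h]
    field_simp
  exact (hp.dvd_or_dvd (h2 ▸ Dvd.intro_left r rfl)).resolve_right hs

/-- quotients of elements with ordered multiplicities. -/
theorem pInt_div {p a b : R} (hp : Prime p) (ha : a ≠ 0) (hb : b ≠ 0)
    (h : multiplicity p b ≤ multiplicity p a) :
    pInt p (algebraMap R (Kq R) a * (algebraMap R (Kq R) b)⁻¹) := by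
  obtain ⟨c, hc, _⟩ := (FiniteMultiplicity.of_prime_left hp ha).exists_eq_pow_mul_and_not_dvd
  obtain ⟨c', hc', hc2⟩ := (FiniteMultiplicity.of_prime_left hp hb).exists_eq_pow_mul_and_not_dvd
  obtain ⟨m, hm⟩ := Nat.exists_eq_add_of_le h
  refine ⟨p ^ m * c, c', hc2, ?_⟩
  have h2 : a * c' = p ^ m * c * b := by
    rw [hc, hm]
    conv_rhs => rw [hc']
    ring
  have hb0 := am_ne hb
  field_simp
  rw [← map_mul, ← map_mul, h2, mul_comm]

theorem pInt_pow_div {p b : R} (hp : Prime p) (hb : b ≠ 0) :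
    ∃ N : ℕ, ∀ M, N ≤ M →
      pInt p (algebraMap R (Kq R) (p ^ M) * (algebraMap R (Kq R) b)⁻¹) := by
  refine ⟨multiplicity p b, fun M hM => pInt_div hp (pow_ne_zero _ hp.ne_zero) hb ?_⟩
  rwa [multiplicity_pow_self hp.ne_zero hp.not_isUnit]

theorem infinite_of_prime {p : R} (hp : Prime p) : Infinite R := by
  by_contra h
  rw [not_infinite_iff_finite] at h
  exact hp.not_isUnit (by
    obtain ⟨b, hb⟩ := (Finite.isDomain_to_isField R).mul_inv_cancel hp.ne_zero
    exact IsUnit.of_mul_eq_one b hb)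

/-- shifting to a non-root. -/
theorem shift [Infinite R] (f w : PK R) (hf : f ≠ 0) (x : R) :
    ∃ x' r : R, eval (algebraMap R (Kq R) x') f ≠ 0 ∧
      eval (algebraMap R (Kq R) x) w = eval (algebraMap R (Kq R) x') w + algebraMap R (Kq R) r := by
  obtain ⟨c, hc, hW⟩ := IsLocalization.integerNormalization_spec (nonZeroDivisors R) w
  set W := IsLocalization.integerNormalization (nonZeroDivisors R) w
  have hc0 : c ≠ 0 := nonZeroDivisors.ne_zero hc
  have hc0' := am_ne hc0
  obtain ⟨t, ht⟩ : ∃ t : R, eval (algebraMap R (Kq R) (x + c * t)) f ≠ 0 := by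
    by_contra hcon
    push Not at hcon
    apply hf
    apply Polynomial.eq_zero_of_infinite_isRoot
    refine (Set.infinite_range_of_injective (f := fun t : R => algebraMap R (Kq R) (x + c * t))
      ?_).mono ?_
    · intro a b hab
      have := aminj hab
      exact mul_left_cancel₀ hc0 (add_left_cancel this)
    · rintro _ ⟨t, rfl⟩
      exact hcon t
  have key : ∀ y : R, algebraMap R (Kq R) c * eval (algebraMap R (Kq R) y) w =
      algebraMap R (Kq R) (eval y W) := by
    intro y
    rw [← eval₂_at_apply, ← eval_map, hW]
    simp [Algebra.smul_def]
  obtain ⟨r, hr⟩ := W.sub_dvd_eval_sub x (x + c * t)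
  refine ⟨x + c * t, -(t * r), ht, ?_⟩
  have h1 : eval x W = eval (x + c * t) W + c * (-(t * r)) := by
    linear_combination hr
  have h2 := congrArg (algebraMap R (Kq R)) h1
  rw [map_add, map_mul, ← key, ← key, ← mul_add] at h2
  exact mul_left_cancel₀ hc0' h2


theorem clear (w : PK R) : ∃ c : R, c ≠ 0 ∧ ∃ W : R[X], W.map (algebraMap R (Kq R)) =
      C (algebraMap R (Kq R) c) * w ∧ (w ≠ 0 → W ≠ 0) ∧
    ∀ y : R, algebraMap R (Kq R) c * eval (algebraMap R (Kq R) y) w =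
      algebraMap R (Kq R) (eval y W) := by
  obtain ⟨c, hc, hW⟩ := IsLocalization.integerNormalization_spec (nonZeroDivisors R) w
  have hW' : (IsLocalization.integerNormalization (nonZeroDivisors R) w).map
      (algebraMap R (Kq R)) = C (algebraMap R (Kq R) c) * w := by
    rw [hW]; ext n; simp [Algebra.smul_def]
  have hc0 := nonZeroDivisors.ne_zero hc
  refine ⟨c, hc0, _, hW', ?_, ?_⟩
  · intro hw h
    rw [h, Polynomial.map_zero] at hW'
    exact mul_ne_zero (C_ne_zero.2 (am_ne hc0)) hw hW'.symm
  · intro y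
    rw [← eval₂_at_apply, ← eval_map, hW']
    simp

theorem eval_ne_of_dvd {f w : PK R} {k : ℕ} (hw : w ∣ f ^ k) {x : Kq R} (hx : eval x f ≠ 0) :
    eval x w ≠ 0 := by
  intro h
  obtain ⟨v, hv⟩ := hw
  have := congrArg (eval x) hv
  rw [eval_pow, eval_mul, h, zero_mul] at this
  exact pow_ne_zero k hx this

theorem lemD {p : R} (hp : Prime p) (f : PK R) (hf0 : f ≠ 0) :
    ∃ T : Set R, T.Finite ∧ (∀ x ∈ T, eval (algebraMap R (Kq R) x) f ≠ 0) ∧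
      ∀ (w : PK R) (k : ℕ), w ∣ f ^ k → (∀ x ∈ T, pInt p (eval (algebraMap R (Kq R) x) w)) →
        ∀ x : R, pInt p (eval (algebraMap R (Kq R) x) w) := by
  classical
  have := infinite_of_prime hp
  let ι := {π : PK R // π ∈ (UniqueFactorizationMonoid.factors f).toFinset}
  let α := {x : R // eval (algebraMap R (Kq R) x) f ≠ 0}
  choose b hb W _ _ hW using (fun π : ι => clear (R := R) π.1)
  obtain ⟨T, hT, hdom⟩ := dickson (fun (x : α) (π : ι) => multiplicity p (eval x.1 (W π)))
  have main : ∀ x y : α, (∀ π : ι, multiplicity p (eval y.1 (W π)) ≤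
      multiplicity p (eval x.1 (W π))) → ∀ (w : PK R), ∀ k : ℕ, w ∣ f ^ k →
        pInt p (eval (algebraMap R (Kq R) x.1) w * (eval (algebraMap R (Kq R) y.1) w)⁻¹) := by
    intro x y hxy w
    induction w using UniqueFactorizationMonoid.induction_on_prime with
    | h₁ =>
      intro k _
      simpa using pInt_of hp 0
    | h₂ u hu =>
      intro k _
      obtain ⟨c, hc, rfl⟩ := Polynomial.isUnit_iff.1 hu
      simp only [eval_C]
      rw [mul_inv_cancel₀ hc.ne_zero]
      simpa using pInt_of hp 1
    | h₃ a π ha hπ ih =>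
      intro k hk
      have hπk := (dvd_mul_right π a).trans hk
      have hπf := hπ.dvd_of_dvd_pow hπk
      obtain ⟨π', hπ', hass⟩ :=
        UniqueFactorizationMonoid.exists_mem_factors_of_dvd hf0 hπ.irreducible hπf
      obtain ⟨u, hu⟩ := hass.symm
      obtain ⟨c, hc, hcu⟩ := Polynomial.isUnit_iff.1 u.isUnit
      have hc0 := hc.ne_zero
      let i : ι := ⟨π', Multiset.mem_toFinset.2 hπ'⟩
      have hev : ∀ z : Kq R, eval z π = eval z π' * c := by
        intro z
        rw [← hu, ← hcu, eval_mul, eval_C]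
      have hπ'f : π' ∣ f ^ 1 := by
        rw [pow_one]
        exact UniqueFactorizationMonoid.dvd_of_mem_factors hπ'
      have hx := eval_ne_of_dvd hπ'f x.2
      have hy := eval_ne_of_dvd hπ'f y.2
      have hb0 := am_ne (hb i)
      have hWne : ∀ z : R, eval (algebraMap R (Kq R) z) π' ≠ 0 → eval z (W i) ≠ 0 := by
        intro z hz h0
        have := hW i z
        rw [h0, map_zero] at this
        exact mul_ne_zero hb0 hz this
      have h1 := pInt_div hp (hWne _ hx) (hWne _ hy) (hxy i)
      rw [← hW, ← hW] at h1
      have h2 := pInt_mul hp h1 (ih k ((dvd_mul_left a π).trans hk))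
      convert h2 using 1
      rw [eval_mul, eval_mul, hev, hev]
      have hx' : eval (algebraMap R (Kq R) x.1) i.1 ≠ 0 := hx
      have hy' : eval (algebraMap R (Kq R) y.1) i.1 ≠ 0 := hy
      have hay := eval_ne_of_dvd ((dvd_mul_left a π).trans hk) y.2
      change _ = algebraMap R (Kq R) (b i) * eval (algebraMap R (Kq R) x.1) π' *
        (algebraMap R (Kq R) (b i) * eval (algebraMap R (Kq R) y.1) π')⁻¹ * _
      field_simp
  refine ⟨Subtype.val '' T, hT.image _, ?_, ?_⟩
  · rintro _ ⟨x, _, rfl⟩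
    exact x.2
  · intro w k hw hTw x
    obtain ⟨x', r, hx', hr⟩ := shift f w hf0 x
    rw [hr]
    refine pInt_add hp ?_ (pInt_of hp r)
    obtain ⟨y, hyT, hy⟩ := hdom ⟨x', hx'⟩
    have h1 := main ⟨x', hx'⟩ y (fun i => hy i) w k hw
    have h2 := pInt_mul hp h1 (hTw y.1 ⟨y, hyT, rfl⟩)
    rwa [inv_mul_cancel_right₀ (eval_ne_of_dvd hw y.2)] at h2

/-- scaling to a polynomial over `R` not divisible by `p`. -/
theorem pprim {p : R} (hp : Prime p) (w : PK R) (hw : w ≠ 0) :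
    ∃ κ : Kq R, κ ≠ 0 ∧ ∃ W : R[X], W.map (algebraMap R (Kq R)) = C κ * w ∧ ¬ C p ∣ W := by
  obtain ⟨c, hc, W, hW, hW0, -⟩ := clear w
  have hCp : Prime (C p : R[X]) := Polynomial.prime_C_iff.2 hp
  obtain ⟨V, hV, hV2⟩ :=
    (FiniteMultiplicity.of_prime_left hCp (hW0 hw)).exists_eq_pow_mul_and_not_dvd
  have hp0 := am_ne hp.ne_zero
  have hc0 := am_ne hc
  refine ⟨(algebraMap R (Kq R) p ^ multiplicity (C p) W)⁻¹ * algebraMap R (Kq R) c,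
    mul_ne_zero (inv_ne_zero (pow_ne_zero _ hp0)) hc0, V, ?_, hV2⟩
  have h1 := congrArg (Polynomial.map (algebraMap R (Kq R))) hV
  rw [hW, Polynomial.map_mul, Polynomial.map_pow, map_C] at h1
  rw [C_mul, mul_assoc, h1, ← C_pow, ← mul_assoc, ← C_mul,
    inv_mul_cancel₀ (pow_ne_zero _ hp0), C_1, one_mul]

theorem map_inj {A B : R[X]} (h : A.map (algebraMap R (Kq R)) = B.map (algebraMap R (Kq R))) :
    A = B := Polynomial.map_injective _ aminj h

/-- the scaling factor between polynomials not divisible by `p` is `p`-integral. -/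
theorem scale_pInt {p : R} (hp : Prime p) {A B : R[X]} (hA : ¬ C p ∣ A)
    {κ : Kq R} (h : B.map (algebraMap R (Kq R)) = C κ * A.map (algebraMap R (Kq R))) :
    pInt p κ := by
  have hCp : Prime (C p : R[X]) := Polynomial.prime_C_iff.2 hp
  obtain ⟨a, b, hab, rfl⟩ := IsFractionRing.exists_reduced_fraction R κ
  refine ⟨a, b, ?_, IsLocalization.mk'_spec _ _ _⟩
  intro hpb
  have h2 : C (b : R) * B = C a * A := by
    apply map_inj
    rw [Polynomial.map_mul, Polynomial.map_mul, h, map_C, map_C, ← mul_assoc, ← C_mul,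
      mul_comm (algebraMap R (Kq R) b), IsLocalization.mk'_spec]
  have h3 : C p ∣ C a * A := h2 ▸ ((map_dvd C hpb).mul_right B)
  rcases hCp.dvd_or_dvd h3 with h4 | h4
  · have : p ∣ a := by
      have := C_dvd_iff_dvd_coeff p (C a) |>.1 h4 0
      simpa using this
    exact hp.not_isUnit (hab this hpb)
  · exact hA h4

theorem rx_lift {f : PK R} (hf : f ∈ rxSet R) : ∃ F : R[X], F.map (algebraMap R (Kq R)) = f := by
  have : f ∈ Polynomial.lifts (algebraMap R (Kq R)) := by
    rw [Polynomial.lifts_iff_coeff_lifts]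
    intro n
    obtain ⟨r, hr⟩ := hf n
    exact ⟨r, hr.symm⟩
  exact (Polynomial.mem_lifts _).1 this

theorem map_eval (F : R[X]) (x : R) : eval (algebraMap R (Kq R) x) (F.map (algebraMap R (Kq R))) =
    algebraMap R (Kq R) (eval x F) := by
  rw [eval_map, eval₂_at_apply]

/-- if `p` does not divide `f(x₀)`, then elements of `[[f]]` have trivial `p`-content. -/
theorem unit_content {p : R} (hp : Prime p) {f : PK R} (hf : f ∈ rxSet R) {x₀ : R}
    (hx₀ : ¬ ∃ r, eval (algebraMap R (Kq R) x₀) f = algebraMap R (Kq R) (p * r))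
    {u : PK R} (hu : u ∈ mon R f) {κ : Kq R} (hκ : κ ≠ 0) {W : R[X]}
    (hW : W.map (algebraMap R (Kq R)) = C κ * u) (hpW : ¬ C p ∣ W) :
    pInt p κ ∧ pInt p κ⁻¹ := by
  have hCp : Prime (C p : R[X]) := Polynomial.prime_C_iff.2 hp
  obtain ⟨F, rfl⟩ := rx_lift hf
  obtain ⟨hui, hu0, k, v, hvi, huv⟩ := hu
  have hpF : ¬ p ∣ eval x₀ F := by
    rintro ⟨r, hr⟩
    exact hx₀ ⟨r, by rw [map_eval, hr]⟩
  have hpF' : ¬ C p ∣ F ^ k := by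
    rintro ⟨G, hG⟩
    apply hpF
    apply hp.dvd_of_dvd_pow (n := k)
    rw [← eval_pow, hG]
    simp
  have hv0 : v ≠ 0 := by
    rintro rfl
    rw [mul_zero, ← Polynomial.map_pow] at huv
    apply hpF'
    rw [map_inj (A := F ^ k) (B := 0) (by rw [← huv, Polynomial.map_zero])]
    exact dvd_zero _
  obtain ⟨ρ, hρ, V, hV, hpV⟩ := pprim hp v hv0
  have hmulW : ¬ C p ∣ W * V := fun h => (hCp.dvd_or_dvd h).elim hpW hpV
  obtain ⟨a, ha⟩ := hui x₀
  obtain ⟨b, hb⟩ := hvi x₀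
  have hab : a * b = eval x₀ F ^ k := by
    apply aminj
    have := congrArg (eval (algebraMap R (Kq R) x₀)) huv
    rw [eval_mul, eval_pow, ha, hb, map_eval] at this
    rw [map_mul, map_pow, this]
  have hpab : ¬ p ∣ a * b := by
    rw [hab]; exact fun h => hpF (hp.dvd_of_dvd_pow h)
  have hκp : pInt p κ := by
    refine ⟨eval x₀ W, a, fun h => hpab (h.mul_right b), ?_⟩
    rw [← map_eval, hW, eval_mul, eval_C, ha]
  have hρp : pInt p ρ := by
    refine ⟨eval x₀ V, b, fun h => hpab (h.mul_left a), ?_⟩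
    rw [← map_eval, hV, eval_mul, eval_C, hb]
  refine ⟨hκp, ?_⟩
  have h1 : pInt p (κ * ρ)⁻¹ := by
    refine scale_pInt hp hmulW (B := F ^ k) ?_
    rw [Polynomial.map_mul, hW, hV, Polynomial.map_pow, ← huv]
    have : (C (κ * ρ)⁻¹ : PK R) * (C κ * C ρ) = 1 := by
      rw [← C_mul, ← C_mul, inv_mul_cancel₀ (mul_ne_zero hκ hρ), C_1]
    linear_combination (-(u * v)) * this
  have h2 := pInt_mul hp hρp h1
  convert h2 using 1
  field_simp

theorem content_int {p : R} (hp : Prime p) {f : PK R} (hf : f ∈ rxSet R) {x₀ : R}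
    (hx₀ : ¬ ∃ r, eval (algebraMap R (Kq R) x₀) f = algebraMap R (Kq R) (p * r))
    {g t : PK R} (hg : g ∈ mon R f) (hgt : g * t ∈ mon R f) (x : R) :
    pInt p (eval (algebraMap R (Kq R) x) t) := by
  have hCp : Prime (C p : R[X]) := Polynomial.prime_C_iff.2 hp
  have ht0 : t ≠ 0 := right_ne_zero_of_mul hgt.2.1
  obtain ⟨κ, hκ, G, hG, hpG⟩ := pprim hp g hg.2.1
  obtain ⟨τ, hτ, T, hT, hpT⟩ := pprim hp t ht0
  have h1 := (unit_content hp hf hx₀ hg hκ hG hpG).1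
  have h2 := (unit_content hp hf hx₀ hgt (mul_ne_zero hκ hτ) (W := G * T)
    (by rw [Polynomial.map_mul, hG, hT, C_mul]; ring)
    (fun h => (hCp.dvd_or_dvd h).elim hpG hpT)).2
  have h3 := pInt_mul hp (pInt_mul hp h1 h2) (pInt_of hp (eval x T))
  convert h3 using 1
  rw [← map_eval, hT, eval_mul, eval_C]
  field_simp

theorem mon_of_mul {f a b : PK R} (ha : a ∈ intSet R) (hb : b ∈ intSet R)
    (hab : a * b ∈ mon R f) : a ∈ mon R f := by
  obtain ⟨_, h0, k, c, hc, h⟩ := hab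
  exact ⟨ha, left_ne_zero_of_mul h0, k, b * c, intSet_mul R hb hc, by rw [← h, mul_assoc]⟩

theorem mon_pow {f g : PK R} (hg : g ∈ mon R f) (n : ℕ) : g ^ n ∈ mon R f := by
  induction n with
  | zero => simpa using mon_one R f
  | succ n ih => rw [pow_succ]; exact mon_mul R ih hg

theorem cpoly_int (r : R) : cpoly R r ∈ intSet R := fun x => ⟨r, by simp [cpoly]⟩

theorem eval_cpoly (r : R) (x : Kq R) : eval x (cpoly R r) = algebraMap R (Kq R) r := by
  simp [cpoly]

/-- division by a constant. -/
theorem div_const {q : R} (hq : q ≠ 0) {h : PK R} (hh : ∀ x : R, ∃ r : R,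
    eval (algebraMap R (Kq R) x) h = algebraMap R (Kq R) (q * r)) :
    ∃ w ∈ intSet R, h = cpoly R q * w := by
  have hq0 := am_ne hq
  refine ⟨C (algebraMap R (Kq R) q)⁻¹ * h, ?_, ?_⟩
  · intro x
    obtain ⟨r, hr⟩ := hh x
    refine ⟨r, ?_⟩
    rw [eval_mul, eval_C, hr, map_mul, inv_mul_cancel_left₀ hq0]
  · rw [cpoly, ← mul_assoc, ← C_mul, mul_inv_cancel₀ hq0, C_1, one_mul]

theorem div_const_mon {q : R} (hq : q ≠ 0) {f h : PK R} (hhm : h ∈ mon R f) (hh : ∀ x : R, ∃ r : R,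
    eval (algebraMap R (Kq R) x) h = algebraMap R (Kq R) (q * r)) :
    cpoly R q ∈ mon R f ∧ ∃ w ∈ mon R f, h = cpoly R q * w := by
  obtain ⟨w, hw, rfl⟩ := div_const hq hh
  exact ⟨mon_of_mul (cpoly_int q) hw hhm, w,
    mon_of_mul hw (cpoly_int q) (by rwa [mul_comm]), rfl⟩

theorem local_bound {p : R} (hp : Prime p) {f : PK R} (hf0 : f ≠ 0)
    {g : PK R} (hg : g ∈ mon R f) : ∃ N : ℕ, ∀ t : PK R, g * t ∈ mon R f → ∀ x : R,
      pInt p (algebraMap R (Kq R) (p ^ N) * eval (algebraMap R (Kq R) x) t) := by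
  obtain ⟨T, hT, hTf, hD⟩ := lemD hp f hf0
  have hgd : ∃ k, g ∣ f ^ k := by
    obtain ⟨_, _, k, v, _, h⟩ := hg
    exact ⟨k, v, h.symm⟩
  obtain ⟨kg, hkg⟩ := hgd
  have hN : ∃ N : ℕ, ∀ x ∈ T, pInt p (algebraMap R (Kq R) (p ^ N) *
      (eval (algebraMap R (Kq R) x) g)⁻¹) := by
    have h1 : ∀ x : R, ∃ N : ℕ, x ∈ T → ∀ M, N ≤ M → pInt p (algebraMap R (Kq R) (p ^ M) *
      (eval (algebraMap R (Kq R) x) g)⁻¹) := by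
      intro x
      by_cases hx : x ∈ T
      · obtain ⟨b, hb⟩ := hg.1 x
        have hb0 : b ≠ 0 := by
          rintro rfl
          rw [map_zero] at hb
          exact eval_ne_of_dvd hkg (hTf x hx) hb
        obtain ⟨N, hN⟩ := pInt_pow_div hp hb0
        exact ⟨N, fun _ => by rw [hb]; exact hN⟩
      · exact ⟨0, fun h => (hx h).elim⟩
    choose N hN using h1
    refine ⟨hT.toFinset.sup N, fun x hx => hN x hx _ (Finset.le_sup ?_)⟩
    exact hT.mem_toFinset.2 hx
  obtain ⟨N, hN⟩ := hN
  refine ⟨N, fun t ht => ?_⟩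
  obtain ⟨hti, _, k, v, _, h⟩ := ht
  have hpN := am_ne (pow_ne_zero N hp.ne_zero)
  have h1 : C (algebraMap R (Kq R) (p ^ N)) * t ∣ f ^ k := by
    rw [(Polynomial.isUnit_C.2 hpN.isUnit).mul_left_dvd]
    exact ⟨g * v, by rw [← h]; ring⟩
  have h2 := hD _ k h1 ?_
  · intro x
    have := h2 x
    rwa [eval_mul, eval_C] at this
  · intro x hx
    obtain ⟨u, hu⟩ := hti x
    have h3 := pInt_mul hp (hN x hx) (pInt_of hp u)
    have hg0 := eval_ne_of_dvd hkg (hTf x hx)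
    rw [eval_mul] at hu
    rw [← hu] at h3
    rw [eval_mul, eval_C]
    convert h3 using 1
    field_simp

theorem bound {f : PK R} (hf : f ∈ rxSet R) (hf0 : f ≠ 0) {g : PK R} (hg : g ∈ mon R f) :
    ∃ c : R, c ≠ 0 ∧ cpoly R c ∈ mon R f ∧ ∀ t : PK R, g * t ∈ mon R f →
      cpoly R c * t ∈ intSet R := by
  classical
  by_cases hR : ∃ p : R, Prime p
  swap
  · refine ⟨1, one_ne_zero, by simpa [cpoly] using mon_one R f, fun t _ x => ?_⟩
    exact int_of_pInt (fun p hp => (hR ⟨p, hp⟩).elim)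
  have hinf : Infinite R := infinite_of_prime hR.choose_spec
  obtain ⟨F, hF⟩ := rx_lift hf
  have hfi : f ∈ intSet R := fun x => ⟨eval x F, by rw [← hF, map_eval]⟩
  have hfm : f ∈ mon R f := ⟨hfi, hf0, 1, 1, intSet_one R, by simp⟩
  obtain ⟨x₀, _, hx₀, _⟩ := shift f 0 hf0 0
  have hFx : eval x₀ F ≠ 0 := by
    intro h
    rw [← hF, map_eval, h, map_zero] at hx₀
    exact hx₀ rfl
  let bad : R → Prop := fun p => ∀ x : R, ∃ r, eval (algebraMap R (Kq R) x) f =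
    algebraMap R (Kq R) (p * r)
  let S := ((UniqueFactorizationMonoid.factors (eval x₀ F)).toFinset).filter bad
  have hSp : ∀ p ∈ S, Prime p := fun p hp =>
    UniqueFactorizationMonoid.prime_of_factor p (Multiset.mem_toFinset.1 (Finset.mem_filter.1 hp).1)
  have hN : ∀ p : R, ∃ N : ℕ, p ∈ S → ∀ t : PK R, g * t ∈ mon R f → ∀ x : R,
      pInt p (algebraMap R (Kq R) (p ^ N) * eval (algebraMap R (Kq R) x) t) := by
    intro p
    by_cases hp : p ∈ S
    · obtain ⟨N, hN⟩ := local_bound (hSp p hp) hf0 hg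
      exact ⟨N, fun _ => hN⟩
    · exact ⟨0, fun h => (hp h).elim⟩
  choose N hN using hN
  refine ⟨∏ p ∈ S, p ^ N p, Finset.prod_ne_zero_iff.2
    (fun p hp => pow_ne_zero _ (hSp p hp).ne_zero), ?_, ?_⟩
  · have : ∀ S' ⊆ S, cpoly R (∏ p ∈ S', p ^ N p) ∈ mon R f := by
      intro S'
      induction S' using Finset.induction_on with
      | empty => intro _; simpa [cpoly] using mon_one R f
      | insert a s ha ih =>
        intro hs
        rw [Finset.prod_insert ha]
        have haS : a ∈ S := hs (Finset.mem_insert_self a s)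
        have h1 := (div_const_mon (hSp a haS).ne_zero hfm (Finset.mem_filter.1 haS).2).1
        have h2 := ih (fun y hy => hs (Finset.mem_insert_of_mem hy))
        have h3 := mon_mul R (mon_pow h1 (N a)) h2
        convert h3 using 1
        simp [cpoly]
    exact this S subset_rfl
  · intro t ht x
    apply int_of_pInt
    intro p hp
    rw [eval_mul, eval_cpoly]
    by_cases hb : bad p
    · obtain ⟨r, hr⟩ := hb x₀
      rw [← hF, map_eval] at hr
      have hpd : p ∣ eval x₀ F := ⟨r, aminj hr⟩
      obtain ⟨p', hp', hass⟩ :=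
        UniqueFactorizationMonoid.exists_mem_factors_of_dvd hFx hp.irreducible hpd
      have hp'S : p' ∈ S := by
        refine Finset.mem_filter.2 ⟨Multiset.mem_toFinset.2 hp', fun y => ?_⟩
        obtain ⟨r, hr⟩ := hb y
        obtain ⟨m, hm⟩ := hass.symm.dvd
        exact ⟨m * r, by rw [hr, hm, mul_assoc]⟩
      apply pInt_assoc hass.symm
      rw [← Finset.mul_prod_erase S _ hp'S, map_mul, mul_right_comm]
      exact pInt_mul (hSp p' hp'S) (hN p' hp'S t ht x) (pInt_of (hSp p' hp'S) _)
    · obtain ⟨x₁, hx₁⟩ := not_forall.1 hb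
      exact pInt_mul hp (pInt_of hp _) (content_int hp hf hx₁ hg ht x)

theorem cic_K {b : R} (hb : b ≠ 0) {k : Kq R}
    (h : ∀ n : ℕ, ∃ r : R, k ^ n * algebraMap R (Kq R) b = algebraMap R (Kq R) r) :
    ∃ r : R, k = algebraMap R (Kq R) r := by
  apply int_of_pInt
  intro p hp
  obtain ⟨a, β, hab, rfl⟩ := IsFractionRing.exists_reduced_fraction R k
  refine ⟨a, β, fun hpβ => ?_, IsLocalization.mk'_spec _ _ _⟩
  have hpa : ¬ p ∣ a := fun h => hp.not_isUnit (hab h hpβ)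
  obtain ⟨n, hn⟩ := FiniteMultiplicity.of_prime_left hp hb
  apply hn
  obtain ⟨r, hr⟩ := h (n + 1)
  have h2 : a ^ (n + 1) * b = (β : R) ^ (n + 1) * r := by
    apply aminj
    rw [map_mul, map_mul, ← hr, map_pow, map_pow, ← IsLocalization.mk'_spec (Kq R) a β, mul_pow]
    ring
  have h3 : p ^ (n + 1) ∣ a ^ (n + 1) * b := h2 ▸ (pow_dvd_pow_of_dvd hpβ _).mul_right r
  exact hp.pow_dvd_of_dvd_mul_left (n + 1) (fun h => hpa (hp.dvd_of_dvd_pow h)) h3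

theorem lemA {f g y : PK R} (hg : g ∈ mon R f) (h : ∀ n : ℕ, y ^ n * g ∈ mon R f) :
    y ∈ mon R f := by
  have hyi : y ∈ intSet R := by
    by_cases hR : ∃ p : R, Prime p
    swap
    · exact fun x => int_of_pInt (fun p hp => (hR ⟨p, hp⟩).elim)
    have hinf : Infinite R := infinite_of_prime hR.choose_spec
    intro x
    obtain ⟨x', r, hx', hr⟩ := shift g y hg.2.1 x
    obtain ⟨b, hb⟩ := hg.1 x'
    have hb0 : b ≠ 0 := by
      rintro rfl
      rw [map_zero] at hb
      exact hx' hb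
    obtain ⟨s, hs⟩ := cic_K hb0 (k := eval (algebraMap R (Kq R) x') y) (by
      intro n
      obtain ⟨s, hs⟩ := (h n).1 x'
      exact ⟨s, by rw [← hb, ← hs, eval_mul, eval_pow]⟩)
    exact ⟨s + r, by rw [hr, hs, map_add]⟩
  refine mon_of_mul hyi hg.1 ?_
  simpa using h 1

theorem jinj : Function.Injective (algebraMap (PK R) (FF R)) := IsFractionRing.injective _ _

theorem j_ne {a : PK R} (h : a ≠ 0) : algebraMap (PK R) (FF R) a ≠ 0 := by
  rwa [Ne, map_eq_zero_iff _ jinj]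

theorem self_mem_pIdlP {f g : PK R} (hg : g ∈ mon R f) : g ∈ pIdlP R f g :=
  ⟨hg, 1, by simp⟩

/-- a polynomial multiplying `P_g` into `[[f]]` lies in `[[f]]`. -/
theorem lemA' {f g y : PK R} (hg : g ∈ mon R f) (h : ∀ u ∈ pIdlP R f g, y * u ∈ mon R f) :
    y ∈ mon R f := by
  have h2 : ∀ n : ℕ, y ^ n * g ∈ pIdlP R f g := by
    intro n
    induction n with
    | zero => simpa using self_mem_pIdlP hg
    | succ n ih =>
      have := h _ ih
      refine ⟨?_, y ^ (n + 1), by ring⟩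
      convert this using 1
      ring
  exact lemA hg (fun n => (h2 n).1)

theorem vcl_pIdl {f : PK R} (hf : f ∈ rxSet R) (hf0 : f ≠ 0) {g : PK R} (hg : g ∈ mon R f) :
    vcl (Hmon R f : Set (FF R)) (pIdl R f g) = pIdl R f g := by
  apply Set.Subset.antisymm _ (subset_vcl _ _)
  intro y hy
  obtain ⟨c, hc, hcm, hct⟩ := bound hf hf0 hg
  have h1 : y * 1 ∈ (Hmon R f : Set (FF R)) := by
    apply hy
    rintro _ ⟨u, hu, rfl⟩
    rw [one_mul]
    exact ⟨u, hu.1, rfl⟩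
  rw [mul_one] at h1
  obtain ⟨Y, hY, rfl⟩ := h1
  have hg0 := j_ne hg.2.1
  have h2 : algebraMap (PK R) (FF R) Y * (algebraMap (PK R) (FF R) (cpoly R c) *
      (algebraMap (PK R) (FF R) g)⁻¹) ∈ (Hmon R f : Set (FF R)) := by
    apply hy
    rintro _ ⟨_, ⟨hu, t, rfl⟩, rfl⟩
    refine ⟨cpoly R c * t, ?_, ?_⟩
    · refine mon_of_mul (hct t hu) hg.1 ?_
      convert mon_mul R hcm hu using 1
      ring
    · rw [map_mul, map_mul]
      field_simp
  obtain ⟨w, hw, hwe⟩ := h2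
  have h3 : g * w = cpoly R c * Y := by
    apply jinj
    rw [map_mul, hwe, map_mul]
    field_simp
  have hc0 := am_ne hc
  refine ⟨Y, ⟨hY, C (algebraMap R (Kq R) c)⁻¹ * w, ?_⟩, rfl⟩
  rw [mul_left_comm, h3, cpoly, ← mul_assoc, ← C_mul, inv_mul_cancel₀ hc0, C_1, one_mul]

theorem part1 {f : PK R} (hf : f ∈ rxSet R) (hf0 : f ≠ 0) {g h : PK R} (hg : g ∈ mon R f)
    (hh : h ∈ mon R f) :
    vcl (Hmon R f : Set (FF R)) (pIdl R f g * pIdl R f h) = pIdl R f (g * h) := by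
  apply Set.Subset.antisymm
  · rw [← vcl_pIdl hf hf0 (mon_mul R hg hh)]
    apply vcl_mono
    rintro _ ⟨_, ⟨_, ⟨hu, a, rfl⟩, rfl⟩, _, ⟨_, ⟨hv, b, rfl⟩, rfl⟩, rfl⟩
    exact ⟨g * a * (h * b), ⟨mon_mul R hu hv, a * b, by ring⟩, map_mul _ _ _⟩
  · rintro _ ⟨_, ⟨hx, t, rfl⟩, rfl⟩ z hz
    obtain ⟨w, hw, hwe⟩ := hz _ (Set.mul_mem_mul ⟨g, self_mem_pIdlP hg, rfl⟩
      ⟨h, self_mem_pIdlP hh, rfl⟩)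
    have hy : algebraMap (PK R) (FF R) (g * h * t) * z = algebraMap (PK R) (FF R) (w * t) := by
      rw [map_mul _ w t, hwe, map_mul, map_mul]
      ring
    rw [hy]
    refine ⟨w * t, ?_, rfl⟩
    refine lemA' hg (fun u hu => lemA' hh (fun v hv => ?_))
    obtain ⟨s, hs, hse⟩ := hz _ (Set.mul_mem_mul ⟨u, hu, rfl⟩ ⟨v, hv, rfl⟩)
    have : w * t * u * v = g * h * t * s := by
      apply jinj
      rw [map_mul, map_mul, ← hy, map_mul _ (g * h * t) s, hse]
      ring
    rw [this]
    exact mon_mul R hx hs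

theorem pow_vcl {f : PK R} (hf : f ∈ rxSet R) (hf0 : f ≠ 0) {g : PK R} (hg : g ∈ mon R f) (n : ℕ) :
    vcl (Hmon R f : Set (FF R)) (pIdl R f g ^ n) = pIdl R f (g ^ n) := by
  induction n with
  | zero =>
    rw [pow_zero, pow_zero]
    have h1 : pIdl R f 1 = (Hmon R f : Set (FF R)) := by
      apply Set.Subset.antisymm
      · rintro _ ⟨u, hu, rfl⟩
        exact ⟨u, hu.1, rfl⟩
      · rintro _ ⟨u, hu, rfl⟩
        exact ⟨u, ⟨hu, u, by simp⟩, rfl⟩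
    rw [h1]
    conv_rhs => rw [← vcl_coe]
    apply Set.Subset.antisymm
    · apply vcl_mono
      rw [Set.one_subset]
      exact (Hmon R f).one_mem
    · rw [← vcl_idem _ (1 : Set (FF R))]
      apply vcl_mono
      intro x hx
      have := hstab_vcl (X := (1 : Set (FF R))) (S := (Hmon R f : Set (FF R)))
        (fun a ha b hb => mul_mem ha hb) 1 (subset_vcl _ _ Set.one_mem_one) x hx
      rwa [one_mul] at this
  | succ n ih =>
    rw [pow_succ, ← vcl_mul_vcl_left, ih, part1 hf hf0 (mon_pow hg n) hg, pow_succ]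

theorem part2 {f : PK R} (hf : f ∈ rxSet R) (hf0 : f ≠ 0) {g : PK R} (hg : g ∈ mon R f)
    {y : PK R} (hy : y ∈ mon R f) :
    vexp (Hmon R f : Set (FF R)) (pIdl R f g)
            ({algebraMap (PK R) (FF R) y} * (Hmon R f : Set (FF R))) = expOf g y := by
  unfold vexp expOf
  congr 1
  ext n
  change ({algebraMap (PK R) (FF R) y} * (Hmon R f : Set (FF R)) : Set (FF R)) ⊆
    vcl (Hmon R f : Set (FF R)) (pIdl R f g ^ n) ↔ g ^ n ∣ y
  rw [pow_vcl hf hf0 hg]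
  constructor
  · intro h
    obtain ⟨u, ⟨hu, t, ht⟩, hue⟩ := h ⟨_, rfl, 1, (Hmon R f).one_mem, mul_one _⟩
    rw [jinj hue] at ht
    exact ⟨t, ht⟩
  · rintro ⟨t, ht⟩ _ ⟨_, rfl, _, ⟨v, hv, rfl⟩, rfl⟩
    exact ⟨y * v, ⟨mon_mul R hy hv, t * v, by rw [ht]; ring⟩, map_mul _ _ _⟩

theorem part3 {d : PK R → R} (hd : IsImageGcdFun R d) {f : PK R} (hf : f ∈ rxSet R) (hf0 : f ≠ 0)
    {g : PK R} (hg : g ∈ mon R f) {e : R} (he : IsEfVal R d f g e)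
    {Q : Set (FF R)} (hQ : IsHeightOnePrime (Hmon R f : Set (FF R)) Q)
    {q : R} (hqi : Irreducible q) (hqQ : algebraMap (PK R) (FF R) (cpoly R q) ∈ Q) :
    vexp (Hmon R f : Set (FF R)) Q
            ({algebraMap (PK R) (FF R) g} * (Hmon R f : Set (FF R))) ≤ expOf q e := by
  classical
  have hq : Prime q := hqi.prime
  have hinf : Infinite R := infinite_of_prime hq
  obtain ⟨⟨⟨hQS, hQid⟩, hQp⟩, _, hQmin⟩ := hQ
  have hqm : cpoly R q ∈ mon R f := by
    obtain ⟨a, ha, hae⟩ := hQS hqQ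
    rwa [jinj hae] at ha
  -- the ideal attached to a point
  let 𝔮 : R → Set (FF R) := fun x => algebraMap (PK R) (FF R) ''
    {h | h ∈ mon R f ∧ ∃ r, eval (algebraMap R (Kq R) x) h = algebraMap R (Kq R) (q * r)}
  have h𝔮p : ∀ x, IsPrimeSIdeal (Hmon R f : Set (FF R)) (𝔮 x) := by
    intro x
    refine ⟨⟨?_, ?_⟩, ?_⟩
    · rintro _ ⟨h, hh, rfl⟩
      exact ⟨h, hh.1, rfl⟩
    · rintro _ ⟨h, ⟨hh, r, hr⟩, rfl⟩ _ ⟨k, hk, rfl⟩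
      obtain ⟨s, hs⟩ := hk.1 x
      exact ⟨h * k, ⟨mon_mul R hh hk, r * s, by rw [eval_mul, hr, hs, ← map_mul, mul_assoc]⟩,
        map_mul _ _ _⟩
    · rintro _ ⟨a, ha, rfl⟩ _ ⟨b, hb, rfl⟩ ⟨c, ⟨hc, r, hr⟩, hce⟩
      rw [← map_mul] at hce
      rw [jinj hce, eval_mul] at hr
      obtain ⟨s, hs⟩ := ha.1 x
      obtain ⟨t, ht⟩ := hb.1 x
      rw [hs, ht, ← map_mul] at hr
      rcases hq.dvd_or_dvd (Dvd.intro r (aminj hr).symm) with ⟨m, hm⟩ | ⟨m, hm⟩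
      · exact Or.inl ⟨a, ⟨ha, m, by rw [hs, hm]⟩, rfl⟩
      · exact Or.inr ⟨b, ⟨hb, m, by rw [ht, hm]⟩, rfl⟩
  have h𝔮n : ∀ x, (𝔮 x).Nonempty := fun x =>
    ⟨_, cpoly R q, ⟨hqm, 1, by rw [eval_cpoly, mul_one]⟩, rfl⟩
  have h𝔮1 : ∀ x, (1 : FF R) ∉ 𝔮 x := by
    rintro x ⟨h, ⟨_, r, hr⟩, he⟩
    have : h = 1 := jinj (by rw [he, map_one])
    rw [this, eval_one, ← map_one (algebraMap R (Kq R))] at hr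
    exact hq.not_isUnit (IsUnit.of_mul_eq_one r (aminj hr).symm)
  have hQ1 : (1 : FF R) ∉ Q := by
    intro h1
    have : 𝔮 0 = Q := by
      apply hQmin _ (h𝔮p 0) (h𝔮n 0)
      intro z hz
      have := hQid 1 h1 z ((h𝔮p 0).1.1 hz)
      rwa [one_mul] at this
    exact h𝔮1 0 (this ▸ h1)
  have hmemQ : ∀ w ∈ mon R f, algebraMap (PK R) (FF R) (cpoly R q * w) ∈ Q := by
    intro w hw
    rw [map_mul]
    exact hQid _ hqQ _ ⟨w, hw, rfl⟩
  obtain ⟨T, hT, hTf, hD⟩ := lemD hq f hf0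
  -- divisibility by q is tested on T
  have htest : ∀ h ∈ mon R f, (∀ x ∈ T, ∃ r, eval (algebraMap R (Kq R) x) h =
      algebraMap R (Kq R) (q * r)) → ∃ w ∈ mon R f, h = cpoly R q * w := by
    intro h hh hTh
    refine (div_const_mon hq.ne_zero hh ?_).2
    have hq0 := am_ne hq.ne_zero
    have hhi := hh.1
    obtain ⟨_, _, k, v, _, hv⟩ := hh
    have h1 : h * C (algebraMap R (Kq R) q)⁻¹ ∣ f ^ k := by
      rw [(Polynomial.isUnit_C.2 (inv_ne_zero hq0).isUnit).mul_right_dvd]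
      exact ⟨v, hv.symm⟩
    have h2 := hD _ k h1 (by
      intro x hx
      obtain ⟨r, hr⟩ := hTh x hx
      rw [eval_mul, eval_C, hr, map_mul, mul_comm, inv_mul_cancel_left₀ hq0]
      exact pInt_of hq r)
    intro x
    have h3 := h2 x
    obtain ⟨a, ha⟩ := hhi x
    rw [eval_mul, eval_C, ha] at h3
    obtain ⟨m, hm⟩ := dvd_of_pInt hq h3
    exact ⟨m, by rw [ha, hm]⟩
  -- the separating element
  have hsep : ∃ h ∈ mon R f, algebraMap (PK R) (FF R) h ∉ Q ∧
      ∀ x ∈ T, ¬ 𝔮 x ⊆ Q → ∃ r, eval (algebraMap R (Kq R) x) h = algebraMap R (Kq R) (q * r) := by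
    refine hT.induction_on_subset (motive := fun T' _ => ∃ h ∈ mon R f,
      algebraMap (PK R) (FF R) h ∉ Q ∧ ∀ x ∈ T', ¬ 𝔮 x ⊆ Q →
        ∃ r, eval (algebraMap R (Kq R) x) h = algebraMap R (Kq R) (q * r)) T ?_ ?_
    · exact ⟨1, mon_one R f, by rwa [map_one], by simp⟩
    · rintro a T' _ _ _ ⟨h, hh, hhQ, hhT⟩
      by_cases haQ : 𝔮 a ⊆ Q
      · refine ⟨h, hh, hhQ, fun x hx hxQ => ?_⟩
        rcases hx with rfl | hx
        · exact (hxQ haQ).elim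
        · exact hhT x hx hxQ
      · obtain ⟨_, ⟨k, ⟨hk, r, hr⟩, rfl⟩, hkQ⟩ := Set.not_subset.1 haQ
        refine ⟨h * k, mon_mul R hh hk, ?_, fun x hx hxQ => ?_⟩
        · rw [map_mul]
          intro hc
          exact (hQp _ ⟨h, hh, rfl⟩ _ ⟨k, hk, rfl⟩ hc).elim hhQ hkQ
        · rcases hx with rfl | hx
          · obtain ⟨s, hs⟩ := hh.1 x
            exact ⟨r * s, by rw [eval_mul, hr, hs, ← map_mul]; congr 1; ring⟩
          · obtain ⟨s, hs⟩ := hk.1 x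
            obtain ⟨r', hr'⟩ := hhT x hx hxQ
            exact ⟨r' * s, by rw [eval_mul, hr', hs, ← map_mul]; congr 1; ring⟩
  obtain ⟨h₁, hh₁, hh₁Q, hh₁T⟩ := hsep
  have hcQ0 : algebraMap (PK R) (FF R) (cpoly R q) ≠ 0 := j_ne hqm.2.1
  have hmul1 : ∀ u ∈ Q, algebraMap (PK R) (FF R) h₁ * (algebraMap (PK R) (FF R) (cpoly R q))⁻¹ * u ∈
      (Hmon R f : Set (FF R)) := by
    intro u hu
    obtain ⟨U, hU, rfl⟩ := hQS hu
    obtain ⟨w, hw, hwe⟩ := htest (h₁ * U) (mon_mul R hh₁ hU) (by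
      intro x hx
      by_cases hxQ : 𝔮 x ⊆ Q
      · have := hQmin _ (h𝔮p x) (h𝔮n x) hxQ
        rw [← this] at hu
        obtain ⟨U', ⟨_, r, hr⟩, hU'⟩ := hu
        rw [jinj hU'] at hr
        obtain ⟨s, hs⟩ := hh₁.1 x
        exact ⟨s * r, by rw [eval_mul, hr, hs, ← map_mul]; congr 1; ring⟩
      · obtain ⟨r, hr⟩ := hh₁T x hx hxQ
        obtain ⟨s, hs⟩ := hU.1 x
        exact ⟨r * s, by rw [eval_mul, hr, hs, ← map_mul]; congr 1; ring⟩)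
    refine ⟨w, hw, ?_⟩
    have := congrArg (algebraMap (PK R) (FF R)) hwe
    rw [map_mul, map_mul] at this
    rw [mul_right_comm, this, mul_comm, inv_mul_cancel_left₀ hcQ0]
  have hmuln : ∀ n : ℕ, ∀ u ∈ Q ^ n, (algebraMap (PK R) (FF R) h₁ *
      (algebraMap (PK R) (FF R) (cpoly R q))⁻¹) ^ n * u ∈ (Hmon R f : Set (FF R)) := by
    intro n
    induction n with
    | zero =>
      intro u hu
      rw [pow_zero, Set.mem_one] at hu
      rw [hu, pow_zero, mul_one]
      exact (Hmon R f).one_mem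
    | succ n ih =>
      intro u hu
      rw [pow_succ] at hu
      obtain ⟨a, ha, b, hb, rfl⟩ := hu
      have := (Hmon R f).mul_mem (ih a ha) (hmul1 b hb)
      rw [pow_succ]
      rw [mul_mul_mul_comm] at this
      exact this
  have hpowQ : ∀ n : ℕ, algebraMap (PK R) (FF R) (h₁ ^ n) ∉ Q := by
    intro n
    induction n with
    | zero => rwa [pow_zero, map_one]
    | succ n ih =>
      rw [pow_succ, map_mul]
      intro hc
      exact (hQp _ ⟨_, mon_pow hh₁ n, rfl⟩ _ ⟨h₁, hh₁, rfl⟩ hc).elim ih hh₁Q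
  -- e is nonzero
  have he0 : e ≠ 0 := by
    obtain ⟨c, hc, hcm, hct⟩ := bound hf hf0 hg
    have : e ∣ c := by
      apply he.2
      intro h hh
      have hgh := mon_mul R hg hh
      obtain ⟨hd1, -⟩ := hd (g * h) hgh.1 hgh.2.1
      have hδ : d (g * h) ≠ 0 := by
        intro h0
        obtain ⟨x, _, hx, _⟩ := shift (g * h) 0 hgh.2.1 0
        obtain ⟨r, hr⟩ := hd1 x
        rw [h0, zero_mul, map_zero] at hr
        exact hx hr
      have hδ0 := am_ne hδ
      obtain ⟨-, w, hw, hwe⟩ := div_const_mon hδ hgh hd1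
      have h1 : g * (C (algebraMap R (Kq R) (d (g * h)))⁻¹ * h) = w := by
        have h0 : C (algebraMap R (Kq R) (d (g * h)))⁻¹ * cpoly R (d (g * h)) = 1 := by
          rw [cpoly, ← C_mul, inv_mul_cancel₀ hδ0, C_1]
        linear_combination C (algebraMap R (Kq R) (d (g * h)))⁻¹ * hwe + w * h0
      have h2 := hct _ (h1 ▸ hw)
      have hch := mon_mul R hcm hh
      obtain ⟨hch1, hch2⟩ := hd (cpoly R c * h) hch.1 hch.2.1
      have h3 : d (g * h) ∣ d (cpoly R c * h) := by
        apply hch2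
        intro x
        obtain ⟨s, hs⟩ := h2 x
        refine ⟨s, ?_⟩
        rw [map_mul, ← hs]
        simp only [eval_mul, eval_C]
        field_simp
      obtain ⟨m, hm⟩ : c ∣ d (cpoly R c * h) := by
        apply hch2
        intro x
        obtain ⟨s, hs⟩ := hh.1 x
        exact ⟨s, by rw [eval_mul, eval_cpoly, hs, map_mul]⟩
      have h4 : m ∣ d h := by
        apply (hd h hh.1 hh.2.1).2
        intro x
        obtain ⟨s, hs⟩ := hch1 x
        refine ⟨s, ?_⟩
        rw [hm, eval_mul, eval_cpoly, mul_assoc, map_mul] at hs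
        exact mul_left_cancel₀ (am_ne hc) hs
      rw [hm, mul_comm c m] at h3
      exact h3.trans (mul_dvd_mul_right h4 c)
    exact ne_zero_of_dvd_ne_zero hc this
  have hkey : ∀ n : ℕ, ({algebraMap (PK R) (FF R) g} * (Hmon R f : Set (FF R)) : Set (FF R)) ⊆
      vcl (Hmon R f : Set (FF R)) (Q ^ n) → q ^ n ∣ e := by
    intro n hn
    have hgv : algebraMap (PK R) (FF R) g ∈ vcl (Hmon R f : Set (FF R)) (Q ^ n) :=
      hn ⟨_, rfl, 1, (Hmon R f).one_mem, mul_one _⟩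
    obtain ⟨w, hw, hwe⟩ := hgv _ (hmuln n)
    have h1 : g * h₁ ^ n = cpoly R q ^ n * w := by
      apply jinj
      rw [map_mul, map_mul, hwe, map_pow, map_pow]
      have h0 : algebraMap (PK R) (FF R) (cpoly R q) ^ n *
          (algebraMap (PK R) (FF R) (cpoly R q))⁻¹ ^ n = 1 := by
        rw [← mul_pow, mul_inv_cancel₀ hcQ0, one_pow]
      rw [mul_pow]
      linear_combination (-(algebraMap (PK R) (FF R) g * algebraMap (PK R) (FF R) h₁ ^ n)) * h0
    have hm₁ := mon_pow hh₁ n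
    have hgm := mon_mul R hg hm₁
    have h2 : q ^ n ∣ d (g * h₁ ^ n) := by
      apply (hd _ hgm.1 hgm.2.1).2
      intro x
      obtain ⟨s, hs⟩ := hw.1 x
      exact ⟨s, by rw [h1, eval_mul, eval_pow, eval_cpoly, hs, map_mul, map_pow]⟩
    have h3 := h2.trans (he.1 _ hm₁)
    refine hq.pow_dvd_of_dvd_mul_left n ?_ h3
    rintro ⟨m, hm⟩
    apply hpowQ n
    obtain ⟨-, w', hw', hwe'⟩ := div_const_mon hq.ne_zero hm₁ (by
      intro x
      obtain ⟨r, hr⟩ := (hd _ hm₁.1 hm₁.2.1).1 x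
      exact ⟨m * r, by rw [hr, hm, mul_assoc]⟩)
    rw [hwe']
    exact hmemQ w' hw'
  have hbdd : BddAbove {n : ℕ | q ^ n ∣ e} := by
    refine ⟨multiplicity q e, fun n hn => ?_⟩
    exact (FiniteMultiplicity.of_prime_left hq he0).le_multiplicity_of_pow_dvd hn
  unfold vexp expOf
  rcases Set.eq_empty_or_nonempty {n : ℕ |
    ({algebraMap (PK R) (FF R) g} * (Hmon R f : Set (FF R)) : Set (FF R)) ⊆
      vcl (Hmon R f : Set (FF R)) (Q ^ n)} with h0 | h0
  · rw [h0]; simp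
  · exact csSup_le h0 (fun n hn => le_csSup hbdd (hkey n hn))

end
end IVPX

/-- Proposition `products`. -/
theorem stmt_11 (R : Type*) [CommRing R] [IsDomain R] [UniqueFactorizationMonoid R]
    (d : PK R → R) (hd : IsImageGcdFun R d)
    (f : PK R) (hf : f ∈ rxSet R) (hf0 : f ≠ 0)
    (e : PK R → R) (he : ∀ g ∈ mon R f, IsEfVal R d f g (e g)) :
    (∀ g ∈ mon R f, ∀ h ∈ mon R f,
        vcl (Hmon R f : Set (FF R)) (pIdl R f g * pIdl R f h) = pIdl R f (g * h)) ∧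
    (∀ g ∈ mon R f, Irreducible g → ∀ y ∈ mon R f, ∀ z ∈ mon R f,
        (vexp (Hmon R f : Set (FF R)) (pIdl R f g)
            ({algebraMap (PK R) (FF R) y} * (Hmon R f : Set (FF R))) : ℤ) -
          (vexp (Hmon R f : Set (FF R)) (pIdl R f g)
            ({algebraMap (PK R) (FF R) z} * (Hmon R f : Set (FF R))) : ℤ) =
        (expOf g y : ℤ) - (expOf g z : ℤ)) ∧
    (∀ g ∈ mon R f, ∀ Q : Set (FF R), IsHeightOnePrime (Hmon R f : Set (FF R)) Q →
        ∀ q : R, Irreducible q → algebraMap (PK R) (FF R) (cpoly R q) ∈ Q →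
        vexp (Hmon R f : Set (FF R)) Q
            ({algebraMap (PK R) (FF R) g} * (Hmon R f : Set (FF R))) ≤
          expOf q (e g)) := by
  refine ⟨fun g hg h hh => IVPX.part1 hf hf0 hg hh, fun g hg _ y hy z hz => ?_,
    fun g hg Q hQ q hq hqQ => IVPX.part3 hd hf hf0 hg (he g hg) hQ hq hqQ⟩
  rw [IVPX.part2 hf hf0 hg hy, IVPX.part2 hf hf0 hg hz]
end

section
/- Let H be a commutative cancellative monoid, 𝕴 a finite nonempty index set, and (L_I)_{I∈𝕴} a family of nonempty s-ideals of H such that (L_I ∪ L_J)_v = H for all distinct I, J ∈ 𝕴. Then (⋂_{I∈𝕴} L_I)_v = ⋂_{I∈𝕴} (L_I)_v. -/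
open Pointwise Polynomial

open IVP Pointwise Polynomial
theorem stmt16_aux {G : Type*} [CommGroup G] (H : Submonoid G)
    {ι : Type*} (L : ι → Set G)
    (hI : ∀ i, IsSIdeal (H : Set G) (L i))
    (hcop : ∀ i j, i ≠ j → ∀ z : G, (∀ x ∈ L i, z * x ∈ H) → (∀ x ∈ L j, z * x ∈ H) → z ∈ H)
    (s : Finset ι) :
    ∃ A : Set G, (∀ x, x ∈ A ↔ x ∈ H ∧ ∀ i ∈ s, x ∈ L i) ∧
      (∀ a ∈ H, (∀ i ∈ s, a ∈ vcl (H : Set G) (L i)) → a ∈ vcl (H : Set G) A) ∧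
      (∀ j, j ∉ s → ∀ z : G, (∀ x ∈ A, z * x ∈ H) → (∀ x ∈ L j, z * x ∈ H) → z ∈ H) := by
  classical
  induction s using Finset.induction_on with
  | empty =>
    refine ⟨H, by simp, fun a ha _ => subset_vcl _ _ ha, fun j _ z hz _ => ?_⟩
    simpa using hz 1 H.one_mem
  | insert k s hk ih =>
    obtain ⟨A, hA, hv, hc⟩ := ih
    have hAmul : ∀ x ∈ A, ∀ b ∈ L k, x * b ∈ A ∩ L k := by
      intro x hx b hb
      have hx' := (hA x).1 hx
      have hbH : b ∈ H := (hI k).1 hb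
      refine ⟨(hA _).2 ⟨mul_mem hx'.1 hbH, fun i hi => (hI i).2 x (hx'.2 i hi) b hbH⟩, ?_⟩
      rw [mul_comm]
      exact (hI k).2 b hb x hx'.1
    refine ⟨A ∩ L k, ?_, ?_, ?_⟩
    · intro x
      simp only [Set.mem_inter_iff, hA, Finset.forall_mem_insert]
      tauto
    · intro a ha hav z hz
      rw [Finset.forall_mem_insert] at hav
      have h1 := hv a ha hav.2
      have h2 := hav.1
      refine hc k hk _ ?_ ?_
      · intro x hx
        have h3 : a * (z * x) ∈ H := h2 (z * x) (fun b hb => by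
          rw [mul_assoc]; exact hz _ (hAmul x hx b hb))
        rwa [← mul_assoc] at h3
      · intro b hb
        have h3 : a * (z * b) ∈ H := h1 (z * b) (fun x hx => by
          rw [mul_assoc, mul_comm b x]; exact hz _ (hAmul x hx b hb))
        rwa [← mul_assoc] at h3
    · intro j hj z hz hzj
      rw [Finset.mem_insert, not_or] at hj
      refine hc j hj.2 z ?_ hzj
      intro x hx
      refine hcop k j (Ne.symm hj.1) _ ?_ ?_
      · intro b hb
        rw [mul_assoc]
        exact hz _ (hAmul x hx b hb)
      · intro c hcj
        rw [mul_right_comm]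
        exact mul_mem (hzj c hcj) ((hA x).1 hx).1

/-- Lemma `interprep`. -/
theorem stmt_16 {G : Type*} [CommGroup G] (H : Submonoid G)
    {ι : Type*} [Finite ι] [Nonempty ι] (L : ι → Set G)
    (hL : ∀ i, (L i).Nonempty ∧ IsSIdeal (H : Set G) (L i))
    (hcop : ∀ i j, i ≠ j → vcl (H : Set G) (L i ∪ L j) = (H : Set G)) :
    vcl (H : Set G) (⋂ i, L i) = ⋂ i, vcl (H : Set G) (L i) := by
  apply Set.Subset.antisymm
  · exact Set.subset_iInter fun i => vcl_mono (Set.iInter_subset L i)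
  · cases nonempty_fintype ι
    obtain ⟨i0⟩ := ‹Nonempty ι›
    obtain ⟨A, hA, hv, -⟩ := stmt16_aux H L (fun i => (hL i).2) (by
      intro i j hij z h1 h2
      have h3 : z ∈ setInv (H : Set G) (L i ∪ L j) := by
        rintro x (hx | hx)
        exacts [h1 x hx, h2 x hx]
      rw [← setInv_vcl, hcop i j hij, setInv_coe] at h3
      exact h3) Finset.univ
    have hAe : A = ⋂ i, L i := by
      ext x
      simp only [hA, Finset.mem_univ, true_imp_iff, Set.mem_iInter]
      exact ⟨fun h => h.2, fun h => ⟨(hL i0).2.1 (h i0), h⟩⟩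
    subst hAe
    intro a ha
    rw [Set.mem_iInter] at ha
    have haH : a ∈ vcl (H : Set G) (H : Set G) := vcl_mono (hL i0).2.1 (ha i0)
    rw [vcl_coe] at haH
    exact hv a haH fun i _ => ha i
end

section
/- Let R be a factorial domain, K a field of quotients of R, X an indeterminate over K, a ∈ R, and f, g ∈ R[X] nonzero such that: the only common divisors of f and g in R[X] are units; the only common divisors of f(a) and g(a) in R are units; and d(rs) = d(r)d(s) for all r ∈ [[f]] and s ∈ [[g]]. Then the divisor-class groups satisfy C_v([[fg]]) ≅ C_v([[f]]) × C_v([[g]]). -/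
open Pointwise Polynomial

open IVP Pointwise Polynomial

namespace IVP18

set_option linter.unusedSectionVars false

section Abs

variable {F : Type*} [Field F]

/-- quotient group membership -/
def Qt (H : Submonoid F) (x : F) : Prop := ∃ r ∈ H, ∃ s ∈ H, x = r / s

theorem Qt.of {H : Submonoid F} {x : F} (h : x ∈ H) : Qt H x := ⟨x, h, 1, H.one_mem, by simp⟩

theorem Qt.mul {H : Submonoid F} {x y : F} (hx : Qt H x) (hy : Qt H y) : Qt H (x * y) := by
  obtain ⟨r, hr, s, hs, rfl⟩ := hx
  obtain ⟨r', hr', s', hs', rfl⟩ := hy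
  exact ⟨r * r', mul_mem hr hr', s * s', mul_mem hs hs', by rw [div_mul_div_comm]⟩

theorem Qt.inv {H : Submonoid F} {x : F} (hx : Qt H x) : Qt H x⁻¹ := by
  obtain ⟨r, hr, s, hs, rfl⟩ := hx
  exact ⟨s, hs, r, hr, by rw [inv_div]⟩

theorem Qt.div {H : Submonoid F} {x y : F} (hx : Qt H x) (hy : Qt H y) : Qt H (x / y) := by
  rw [div_eq_mul_inv]; exact hx.mul hy.inv

/-- splitting data -/
structure Spl (H H1 H2 : Submonoid F) : Prop where
  z1 : (0 : F) ∉ H1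
  z2 : (0 : F) ∉ H2
  mul : (H1 : Set F) * (H2 : Set F) = (H : Set F)
  int1 : ∀ x, Qt H1 x → Qt H2 x → x ∈ H1
  int2 : ∀ x, Qt H1 x → Qt H2 x → x ∈ H2

variable {H H1 H2 : Submonoid F}

theorem Spl.symm (h : Spl H H1 H2) : Spl H H2 H1 :=
  ⟨h.z2, h.z1, by rw [mul_comm]; exact h.mul, fun x a b => h.int2 x b a, fun x a b => h.int1 x b a⟩

theorem Spl.mm (h : Spl H H1 H2) {x y : F} (hx : x ∈ H1) (hy : y ∈ H2) : x * y ∈ H := by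
  have : x * y ∈ (H1 : Set F) * (H2 : Set F) := Set.mul_mem_mul hx hy
  rw [h.mul] at this; exact this

theorem Spl.ex (h : Spl H H1 H2) {x : F} (hx : x ∈ H) : ∃ a ∈ H1, ∃ b ∈ H2, x = a * b := by
  have : x ∈ (H1 : Set F) * (H2 : Set F) := by rw [h.mul]; exact hx
  obtain ⟨a, ha, b, hb, e⟩ := this
  exact ⟨a, ha, b, hb, e.symm⟩

theorem Spl.z (h : Spl H H1 H2) : (0 : F) ∉ H := by
  intro h0
  obtain ⟨a, ha, b, hb, e⟩ := h.ex h0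
  rcases mul_eq_zero.1 e.symm with rfl | rfl
  · exact h.z1 ha
  · exact h.z2 hb

theorem nz {H : Submonoid F} (z : (0 : F) ∉ H) {x : F} (hx : x ∈ H) : x ≠ 0 := by
  rintro rfl; exact z hx

/-- key cancellation -/
theorem Spl.key (h : Spl H H1 H2) {x k1 y k2 : F} (hx : Qt H1 x) (hk1 : k1 ∈ H1) (hy : Qt H2 y)
    (y0 : y ≠ 0) (hk2 : k2 ∈ H2) (e : x * y = k1 * k2) : x ∈ H1 := by
  have k10 := nz h.z1 hk1
  have e1 : x / k1 = k2 / y := by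
    rw [div_eq_div_iff k10 y0, e]; ring
  have h1 : Qt H1 (x / k1) := hx.div (Qt.of hk1)
  have h2 : Qt H2 (x / k1) := by rw [e1]; exact (Qt.of hk2).div hy
  have := mul_mem (h.int1 _ h1 h2) hk1
  rwa [div_mul_cancel₀ _ k10] at this

/-- bounded sets -/
def Bd (H : Submonoid F) (I : Set F) : Prop := I.Nonempty ∧ ∃ a : F, a ≠ 0 ∧ ∀ x ∈ I, a * x ∈ H

theorem Bd.qt {I : Set F} (z : (0 : F) ∉ H) (hI : Bd H I) {x y : F} (hx : x ∈ I) (hy : y ∈ I) :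
    y ≠ 0 ∧ Qt H (x / y) := by
  obtain ⟨_, a, ha, hb⟩ := hI
  refine ⟨right_ne_zero_of_mul (nz z (hb y hy)), a * x, hb x hx, a * y, hb y hy, ?_⟩
  rw [mul_div_mul_left _ _ ha]

theorem Bd.inv {I : Set F} (z : (0 : F) ∉ H) (hI : Bd H I) : Bd H (setInv (H : Set F) I) := by
  obtain ⟨⟨i, hi⟩, a, ha, hb⟩ := hI
  refine ⟨⟨a, hb⟩, i, right_ne_zero_of_mul (nz z (hb i hi)), ?_⟩
  intro x hx
  rw [mul_comm]; exact hx i hi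

theorem Bd.mul {I J : Set F} (hI : Bd H I) (hJ : Bd H J) : Bd H (I * J) := by
  obtain ⟨hi, a, ha, hb⟩ := hI
  obtain ⟨hj, a', ha', hb'⟩ := hJ
  refine ⟨hi.mul hj, a * a', mul_ne_zero ha ha', ?_⟩
  rintro _ ⟨x, hx, y, hy, rfl⟩
  have := mul_mem (hb x hx) (hb' y hy)
  rwa [mul_mul_mul_comm] at this

theorem setInv_aux (h : Spl H H1 H2) {I J : Set F} (hI : Bd H1 I) {i0 j0 h1 h2 z : F}
    (hi0 : i0 ∈ I) (hj0 : j0 ∈ J) (j00 : j0 ≠ 0) (hh1 : h1 ∈ H1) (hh2 : h2 ∈ H2)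
    (hz : z ∈ setInv (H : Set F) (I * J)) (e : z * (i0 * j0) = h1 * h2) :
    h1 / i0 ∈ setInv (H1 : Set F) I := by
  intro i hi
  obtain ⟨i00, hq⟩ := hI.qt h.z1 hi hi0
  obtain ⟨k1, hk1, k2, hk2, e2⟩ := h.ex (hz (i * j0) (Set.mul_mem_mul hi hj0))
  refine h.key (y := h2) (k1 := k1) (k2 := k2) ?_ hk1 (Qt.of hh2) (nz h.z2 hh2) hk2 ?_
  · have : h1 / i0 * i = h1 * (i / i0) := by ring
    rw [this]; exact (Qt.of hh1).mul hq
  · have : h1 / i0 * i * h2 = (h1 * h2) * (i / i0) := by ring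
    rw [this, ← e, ← e2]; field_simp

theorem setInv_mul (h : Spl H H1 H2) {I J : Set F} (hI : Bd H1 I) (hJ : Bd H2 J) :
    setInv (H : Set F) (I * J) = setInv (H1 : Set F) I * setInv (H2 : Set F) J := by
  apply Set.Subset.antisymm
  · intro z hz
    obtain ⟨i0, hi0⟩ := hI.1
    obtain ⟨j0, hj0⟩ := hJ.1
    have i00 := (hI.qt h.z1 hi0 hi0).1
    have j00 := (hJ.qt h.z2 hj0 hj0).1
    obtain ⟨h1, hh1, h2, hh2, e⟩ := h.ex (hz (i0 * j0) (Set.mul_mem_mul hi0 hj0))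
    refine ⟨h1 / i0, setInv_aux h hI hi0 hj0 j00 hh1 hh2 hz e, h2 / j0,
      setInv_aux h.symm hJ hj0 hi0 i00 hh2 hh1 (z := z) (by rwa [mul_comm]) ?_, ?_⟩
    · rw [mul_comm j0, e, mul_comm]
    · show h1 / i0 * (h2 / j0) = z
      rw [div_mul_div_comm, ← e]; field_simp
  · rintro _ ⟨x, hx, y, hy, rfl⟩ _ ⟨i, hi, j, hj, rfl⟩
    have := h.mm (hx i hi) (hy j hj)
    rwa [mul_mul_mul_comm] at this

theorem vcl_mul (h : Spl H H1 H2) {I J : Set F} (hI : Bd H1 I) (hJ : Bd H2 J) :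
    vcl (H : Set F) (I * J) = vcl (H1 : Set F) I * vcl (H2 : Set F) J := by
  unfold vcl
  rw [setInv_mul h hI hJ, setInv_mul h (hI.inv h.z1) (hJ.inv h.z2)]

theorem fbd {I : Set F} (hI : IsFracVIdl H I) : Bd H I := ⟨hI.1, hI.2.1⟩

theorem frac_mul (h : Spl H H1 H2) {I J : Set F} (hI : IsFracVIdl H1 I) (hJ : IsFracVIdl H2 J) :
    IsFracVIdl H (I * J) := by
  obtain ⟨hi, a, ha, hb⟩ := fbd hI
  obtain ⟨hj, a', ha', hb'⟩ := fbd hJ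
  refine ⟨hi.mul hj, ⟨a * a', mul_ne_zero ha ha', ?_⟩, ?_⟩
  · rintro _ ⟨x, hx, y, hy, rfl⟩
    have := h.mm (hb x hx) (hb' y hy)
    rwa [mul_mul_mul_comm] at this
  · rw [vcl_mul h (fbd hI) (fbd hJ), hI.2.2, hJ.2.2]

/-- product map on ideals -/
def Phi (h : Spl H H1 H2) : FIdl H1 × FIdl H2 →* FIdl H where
  toFun p := ⟨p.1.1 * p.2.1, frac_mul h p.1.2 p.2.2⟩
  map_one' := Subtype.ext h.mul
  map_mul' p q := by
    apply Subtype.ext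
    show vcl (H1 : Set F) (p.1.1 * q.1.1) * vcl (H2 : Set F) (p.2.1 * q.2.1) =
      vcl (H : Set F) ((p.1.1 * p.2.1) * (q.1.1 * q.2.1))
    rw [mul_mul_mul_comm, vcl_mul h ((fbd p.1.2).mul (fbd q.1.2)) ((fbd p.2.2).mul (fbd q.2.2))]

theorem prin_mul_val (c : Fˣ) (A : FIdl H) :
    ((prinHom H c : (FIdl H)ˣ) * A : FIdl H).1 = {(c : F)} * A.1 := by
  show vcl (H : Set F) (({(c : F)} * (H : Set F)) * A.1) = {(c : F)} * A.1
  rw [mul_assoc, coe_mul_eq H A.2.2.2]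
  conv_rhs => rw [← A.2.2.2]
  have c0 : (c : F) ≠ 0 := c.ne_zero
  have key : ∀ (d : F) (d0 : d ≠ 0) (X : Set F), setInv (H : Set F) ({d} * X) = {d⁻¹} * setInv (H : Set F) X := by
    intro d d0 X
    apply Set.Subset.antisymm
    · intro z hz
      refine ⟨d⁻¹, rfl, d * z, ?_, by simp [d0]⟩
      intro x hx
      have := hz (d * x) (Set.mul_mem_mul rfl hx)
      rwa [show d * z * x = z * (d * x) by ring]
    · rintro _ ⟨s, hs, y, hy, rfl⟩ _ ⟨t, ht, x, hx, rfl⟩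
      rw [Set.mem_singleton_iff] at hs ht
      subst hs ht
      have := hy x hx
      rwa [show t⁻¹ * y * (t * x) = (t⁻¹ * t) * (y * x) by ring, inv_mul_cancel₀ d0, one_mul]
  unfold vcl
  rw [key _ c0, key _ (inv_ne_zero c0), inv_inv]

theorem stab {I : Set F} (hI : IsFracVIdl H I) {x y : F} (hx : x ∈ I) (hy : y ∈ H) : x * y ∈ I := by
  rw [← hI.2.2] at hx ⊢
  exact hstab_vcl (fun a ha b hb => mul_mem ha hb) x hx y hy

theorem inj_aux (h : Spl H H1 H2) {A A' B B' : Set F} (hA : IsFracVIdl H1 A)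
    (hA' : IsFracVIdl H1 A') (hB' : IsFracVIdl H2 B')
    (e : A * B ⊆ A' * B') {a0 a0' b0 b0' c : F} (ha0 : a0 ∈ A) (ha0' : a0' ∈ A') (hb0 : b0 ∈ B)
    (hb0' : b0' ∈ B') (hc : c * a0 = a0') (hc' : b0 = c * b0') {a : F} (ha : a ∈ A) :
    c * a ∈ A' := by
  obtain ⟨a', ha', b', hb', e1⟩ := e (Set.mul_mem_mul ha hb0)
  have e1 : a' * b' = a * b0 := e1
  obtain ⟨a00, q1⟩ := (fbd hA).qt h.z1 ha ha0
  obtain ⟨a'0, q2⟩ := (fbd hA').qt h.z1 ha0' ha'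
  obtain ⟨b00, q3⟩ := (fbd hB').qt h.z2 hb' hb0'
  have E : c * a / a' = b' / b0' := by
    rw [div_eq_div_iff a'0 b00, mul_comm b', e1, hc']; ring
  have Q1 : Qt H1 (c * a / a') := by
    have : c * a / a' = a / a0 * (a0' / a') := by rw [← hc]; field_simp
    rw [this]; exact q1.mul q2
  have := stab hA' ha' (h.int1 _ Q1 (by rw [E]; exact q3))
  rwa [mul_div_cancel₀ _ a'0] at this

theorem Phi_inj (h : Spl H H1 H2) {p q : FIdl H1 × FIdl H2} (e : Phi h p = Phi h q) :
    ∃ c : Fˣ, q.1 = prinHom H1 c * p.1 ∧ q.2 = prinHom H2 c⁻¹ * p.2 := by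
  have e : p.1.1 * p.2.1 = q.1.1 * q.2.1 := congrArg Subtype.val e
  obtain ⟨⟨A, hA⟩, ⟨B, hB⟩⟩ := p
  obtain ⟨⟨A', hA'⟩, ⟨B', hB'⟩⟩ := q
  simp only at e
  obtain ⟨a0, ha0⟩ := hA.1
  obtain ⟨b0, hb0⟩ := hB.1
  obtain ⟨a0', ha0', b0', hb0', e1⟩ := e ▸ Set.mul_mem_mul ha0 hb0
  have e1 : a0' * b0' = a0 * b0 := e1
  have a00 := ((fbd hA).qt h.z1 ha0 ha0).1
  have a00' := ((fbd hA').qt h.z1 ha0' ha0').1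
  have b00 := ((fbd hB).qt h.z2 hb0 hb0).1
  have b00' := ((fbd hB').qt h.z2 hb0' hb0').1
  have c0 : a0' / a0 ≠ 0 := div_ne_zero a00' a00
  set c := a0' / a0 with hcd
  have hc : c * a0 = a0' := div_mul_cancel₀ _ a00
  have hc' : b0 = c * b0' := by
    rw [hcd]; field_simp; rw [mul_comm, e1.symm]
  refine ⟨Units.mk0 c c0, ?_, ?_⟩
  · apply Subtype.ext
    rw [prin_mul_val]
    simp only [Units.val_mk0]
    apply Set.Subset.antisymm
    · intro x hx
      refine ⟨c, rfl, c⁻¹ * x, ?_, by simp [c0]⟩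
      exact inj_aux h hA' hA hB e.symm.subset ha0' ha0 hb0' hb0 (by rw [← hc]; simp [c0])
        (by rw [hc']; simp [c0]) hx
    · rintro _ ⟨s, hs, x, hx, rfl⟩
      rw [Set.mem_singleton_iff] at hs
      subst hs
      exact inj_aux h hA hA' hB' e.subset ha0 ha0' hb0 hb0' hc hc' hx
  · apply Subtype.ext
    rw [prin_mul_val]
    simp only [Units.val_inv_eq_inv_val, Units.val_mk0]
    rw [mul_comm A, mul_comm A'] at e
    apply Set.Subset.antisymm
    · intro x hx
      refine ⟨c⁻¹, rfl, c * x, ?_, by simp [c0]⟩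
      exact inj_aux h.symm hB' hB hA e.symm.subset hb0' hb0 ha0' ha0 hc'.symm hc.symm hx
    · rintro _ ⟨s, hs, x, hx, rfl⟩
      rw [Set.mem_singleton_iff] at hs
      subst hs
      exact inj_aux h.symm hB hB' hA' e.subset hb0 hb0' ha0 ha0' (by rw [hc']; simp [c0])
        (by rw [← hc]; simp [c0]) hx

theorem frac_setInv {Z : Set F} (z : (0 : F) ∉ H) (hZ : Z ⊆ (H : Set F)) (hn : Z.Nonempty) :
    IsFracVIdl H (setInv (H : Set F) Z) := by
  have b : Bd H (setInv (H : Set F) Z) :=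
    Bd.inv z ⟨hn, 1, one_ne_zero, fun x hx => by rw [one_mul]; exact hZ hx⟩
  exact ⟨b.1, b.2, setInv_vcl _ _⟩

theorem surj_aux (h : Spl H H1 H2) {Z : Set F} {z0 x h1 h2 k1 k2 : F}
    (hx : x ∈ setInv (H : Set F) Z) (hh1 : h1 ∈ H1) (hh2 : h2 ∈ H2)
    (hk1 : k1 ∈ H1) (hk2 : k2 ∈ H2) (e0 : z0 = h1 * h2) (e : x * z0 = k1 * k2) :
    k1 / h1 ∈ setInv (H1 : Set F) {y | y ∈ H1 ∧ ∃ w ∈ H2, y * w ∈ Z} := by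
  rintro y ⟨hy, w, hw, hyw⟩
  obtain ⟨m1, hm1, m2, hm2, e1⟩ := h.ex (hx _ hyw)
  have h10 := nz h.z1 hh1
  have h20 := nz h.z2 hh2
  refine h.key (y := k2 / h2 * w) (k1 := m1) (k2 := m2)
    (((Qt.of hk1).div (Qt.of hh1)).mul (Qt.of hy)) hm1
    (((Qt.of hk2).div (Qt.of hh2)).mul (Qt.of hw))
    (mul_ne_zero (div_ne_zero (nz h.z2 hk2) h20) (nz h.z2 hw)) hm2 ?_
  rw [← e1]
  have : k1 / h1 * y * (k2 / h2 * w) = (k1 * k2) / (h1 * h2) * (y * w) := by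
    field_simp
  rw [this, ← e, ← e0, mul_div_cancel_right₀]
  rw [e0]; exact mul_ne_zero h10 h20

theorem Phi_surj (h : Spl H H1 H2) : Function.Surjective (Phi h) := by
  rintro ⟨I, hI⟩
  obtain ⟨i0, hi0⟩ := hI.1
  have i00 := ((fbd hI).qt h.z hi0 hi0).1
  obtain ⟨_, ⟨a, ha, hab⟩, hv⟩ := id hI
  set Z : Set F := {z | z / i0 ∈ setInv (H : Set F) I} with hZd
  have hZ : Z ⊆ H := by
    intro z hz
    have := hz i0 hi0
    rwa [div_mul_cancel₀ _ i00] at this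
  have hz0 : a * i0 ∈ Z := by
    show a * i0 / i0 ∈ setInv (H : Set F) I
    rw [mul_div_cancel_right₀ _ i00]; exact hab
  obtain ⟨h1, hh1, h2, hh2, e0⟩ := h.ex (hZ hz0)
  have h10 := nz h.z1 hh1
  have h20 := nz h.z2 hh2
  set Z1 : Set F := {y | y ∈ H1 ∧ ∃ w ∈ H2, y * w ∈ Z} with hZ1
  set Z2 : Set F := {y | y ∈ H2 ∧ ∃ w ∈ H1, y * w ∈ Z} with hZ2
  have n1 : Z1.Nonempty := ⟨h1, hh1, h2, hh2, e0 ▸ hz0⟩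
  have n2 : Z2.Nonempty := ⟨h2, hh2, h1, hh1, by rw [mul_comm]; exact e0 ▸ hz0⟩
  have f1 := frac_setInv h.z1 (fun x (hx : x ∈ Z1) => hx.1 : Z1 ⊆ (H1 : Set F)) n1
  have f2 := frac_setInv h.z2 (fun x (hx : x ∈ Z2) => hx.1 : Z2 ⊆ (H2 : Set F)) n2
  let I1 : FIdl H1 := ⟨_, f1⟩
  let I2 : FIdl H2 := ⟨_, f2⟩
  refine ⟨((prinHom H1 (Units.mk0 i0 i00) : (FIdl H1)ˣ) * I1, I2), ?_⟩
  apply Subtype.ext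
  show (((prinHom H1 (Units.mk0 i0 i00) : (FIdl H1)ˣ) * I1 : FIdl H1)).1 *
    setInv (H2 : Set F) Z2 = I
  rw [prin_mul_val, Units.val_mk0, mul_assoc]
  show {i0} * (setInv (H1 : Set F) Z1 * setInv (H2 : Set F) Z2) = I
  have main : setInv (H1 : Set F) Z1 * setInv (H2 : Set F) Z2 = setInv (H : Set F) Z := by
    apply Set.Subset.antisymm
    · rintro _ ⟨x, hx, y, hy, rfl⟩ z hz
      obtain ⟨z1, hz1, z2, hz2, e⟩ := h.ex (hZ hz)
      have a1 := hx z1 ⟨hz1, z2, hz2, e ▸ hz⟩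
      have a2 := hy z2 ⟨hz2, z1, hz1, by rw [mul_comm]; exact e ▸ hz⟩
      have := h.mm a1 a2
      rw [e]
      rwa [mul_mul_mul_comm] at this
    · intro x hx
      obtain ⟨k1, hk1, k2, hk2, e⟩ := h.ex (hx _ hz0)
      refine ⟨k1 / h1, surj_aux h hx hh1 hh2 hk1 hk2 e0 e, k2 / h2,
        surj_aux h.symm (z0 := a * i0) hx hh2 hh1 hk2 hk1 (by rw [e0, mul_comm]) (by rw [e, mul_comm]), ?_⟩
      show k1 / h1 * (k2 / h2) = x
      rw [div_mul_div_comm, ← e, ← e0, mul_div_cancel_right₀]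
      rw [e0]; exact mul_ne_zero h10 h20
  rw [main, ← hv]
  apply Set.Subset.antisymm
  · rintro _ ⟨s, hs, x, hx, rfl⟩
    rw [Set.mem_singleton_iff] at hs
    subst hs
    intro w hw
    have := hx (w * s) (by show w * s / s ∈ setInv (H : Set F) I; rwa [mul_div_cancel_right₀ _ i00])
    rwa [show s * x * w = x * (w * s) by ring]
  · intro x hx
    refine ⟨i0, rfl, x / i0, ?_, by show i0 * (x / i0) = x; field_simp⟩
    intro z hz
    have := hx _ hz
    rwa [show x / i0 * z = x * (z / i0) by ring]

theorem Phi_prin (h : Spl H H1 H2) (a b : Fˣ) :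
    Phi h ((prinHom H1 a : (FIdl H1)ˣ), (prinHom H2 b : (FIdl H2)ˣ)) = (prinHom H (a * b) : (FIdl H)ˣ) := by
  apply Subtype.ext
  show (({(a : F)} : Set F) * (H1 : Set F)) * (({(b : F)} : Set F) * (H2 : Set F)) =
    ({((a * b : Fˣ) : F)} : Set F) * (H : Set F)
  rw [mul_mul_mul_comm, h.mul, Set.singleton_mul_singleton, Units.val_mul]

/-- on units -/
def PhiU (h : Spl H H1 H2) : (FIdl H1)ˣ × (FIdl H2)ˣ →* (FIdl H)ˣ :=
  (Units.map (Phi h)).comp (MulEquiv.prodUnits (M := FIdl H1) (N := FIdl H2)).symm.toMonoidHom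

theorem PhiU_val (h : Spl H H1 H2) (p : (FIdl H1)ˣ × (FIdl H2)ˣ) :
    (PhiU h p : FIdl H) = Phi h ((p.1 : FIdl H1), (p.2 : FIdl H2)) := rfl

theorem PhiU_surj (h : Spl H H1 H2) : Function.Surjective (PhiU h) := by
  intro v
  obtain ⟨p, hp⟩ := Phi_surj h (v : FIdl H)
  obtain ⟨q, hq⟩ := Phi_surj h ((v⁻¹ : (FIdl H)ˣ) : FIdl H)
  have e : Phi h 1 = Phi h (p * q) := by rw [map_mul, hp, hq, Units.mul_inv, map_one]
  obtain ⟨c, h1, h2⟩ := Phi_inj h e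
  have u1 : IsUnit p.1 := by
    apply isUnit_of_mul_isUnit_left (y := q.1)
    have : p.1 * q.1 = (prinHom H1 c : (FIdl H1)ˣ) := by
      simpa using h1
    rw [this]; exact Units.isUnit _
  have u2 : IsUnit p.2 := by
    apply isUnit_of_mul_isUnit_left (y := q.2)
    have : p.2 * q.2 = (prinHom H2 c⁻¹ : (FIdl H2)ˣ) := by
      simpa using h2
    rw [this]; exact Units.isUnit _
  obtain ⟨w1, hw1⟩ := u1
  obtain ⟨w2, hw2⟩ := u2
  refine ⟨(w1, w2), Units.ext ?_⟩
  rw [PhiU_val, ← hp]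
  simp only [hw1, hw2]

theorem PhiU_prin (h : Spl H H1 H2) (p : (FIdl H1)ˣ × (FIdl H2)ˣ) :
    PhiU h p ∈ (prinHom H).range ↔ p.1 ∈ (prinHom H1).range ∧ p.2 ∈ (prinHom H2).range := by
  constructor
  · rintro ⟨c, hc⟩
    have e : Phi h ((prinHom H1 c : (FIdl H1)ˣ), (prinHom H2 1 : (FIdl H2)ˣ)) =
        Phi h ((p.1 : FIdl H1), (p.2 : FIdl H2)) := by
      rw [Phi_prin, mul_one, hc, PhiU_val]
    obtain ⟨b, h1, h2⟩ := Phi_inj h e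
    refine ⟨⟨b * c, Units.ext ?_⟩, ⟨b⁻¹ * 1, Units.ext ?_⟩⟩
    · rw [map_mul, Units.val_mul]; exact h1.symm
    · rw [map_mul, Units.val_mul]; exact h2.symm
  · rintro ⟨⟨a, ha⟩, ⟨b, hb⟩⟩
    refine ⟨a * b, Units.ext ?_⟩
    rw [PhiU_val, ← ha, ← hb, Phi_prin]

theorem Spl.iso (h : Spl H H1 H2) : Nonempty (ClassGrp H ≃* ClassGrp H1 × ClassGrp H2) := by
  let φ : (FIdl H1)ˣ × (FIdl H2)ˣ →* ((FIdl H)ˣ ⧸ (prinHom H).range) :=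
    (QuotientGroup.mk' _).comp (PhiU h)
  let ψ : (FIdl H1)ˣ × (FIdl H2)ˣ →*
      ((FIdl H1)ˣ ⧸ (prinHom H1).range) × ((FIdl H2)ˣ ⧸ (prinHom H2).range) :=
    (QuotientGroup.mk' _).prodMap (QuotientGroup.mk' _)
  have hφ : Function.Surjective φ := (QuotientGroup.mk'_surjective _).comp (PhiU_surj h)
  have hψ : Function.Surjective ψ :=
    Function.Surjective.prodMap (QuotientGroup.mk'_surjective _) (QuotientGroup.mk'_surjective _)
  have hk : φ.ker = ψ.ker := by
    ext p
    rw [MonoidHom.mem_ker, MonoidHom.mem_ker]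
    have a1 : φ p = 1 ↔ PhiU h p ∈ (prinHom H).range := QuotientGroup.eq_one_iff _
    have a2 : ψ p = 1 ↔ p.1 ∈ (prinHom H1).range ∧ p.2 ∈ (prinHom H2).range := by
      rw [Prod.ext_iff]
      exact and_congr (QuotientGroup.eq_one_iff _) (QuotientGroup.eq_one_iff _)
    rw [a1, a2, PhiU_prin]
  exact ⟨(QuotientGroup.quotientKerEquivOfSurjective φ hφ).symm.trans
    ((QuotientGroup.quotientMulEquivOfEq hk).trans
      (QuotientGroup.quotientKerEquivOfSurjective ψ hψ))⟩

end Abs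

section Poly

variable {R : Type*} [CommRing R] [IsDomain R] [UniqueFactorizationMonoid R]

theorem cpoly_int (r : R) : cpoly R r ∈ intSet R := fun x => ⟨r, by simp [cpoly]⟩

theorem cpoly_ne {r : R} (h : r ≠ 0) : cpoly R r ≠ 0 := by
  simpa [cpoly] using h

theorem cpoly_mul (r s : R) : cpoly R (r * s) = cpoly R r * cpoly R s := by
  simp [cpoly]

theorem map_int (P : R[X]) : P.map (algebraMap R (Kq R)) ∈ intSet R := fun x =>
  ⟨P.eval x, by rw [Polynomial.eval_map_algebraMap, Polynomial.aeval_algebraMap_apply]; simp⟩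

theorem int_pow {f : PK R} (hf : f ∈ intSet R) (k : ℕ) : f ^ k ∈ intSet R := by
  induction k with
  | zero => rw [pow_zero]; exact intSet_one R
  | succ n ih => rw [pow_succ]; exact intSet_mul R ih hf

theorem rx_lift {f : PK R} (hf : f ∈ rxSet R) : ∃ P : R[X], P.map (algebraMap R (Kq R)) = f := by
  have : f ∈ Polynomial.lifts (algebraMap R (Kq R)) := by
    rw [Polynomial.lifts_iff_coeff_lifts]
    intro n
    obtain ⟨r, hr⟩ := hf n
    exact ⟨r, hr.symm⟩
  exact (Polynomial.mem_lifts _).1 this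

theorem map_rx (P : R[X]) : P.map (algebraMap R (Kq R)) ∈ rxSet R := fun n =>
  ⟨P.coeff n, by rw [Polynomial.coeff_map]⟩

theorem amap_inj : Function.Injective (algebraMap R (Kq R)) := IsFractionRing.injective R (Kq R)

theorem pmap_inj : Function.Injective (Polynomial.map (algebraMap R (Kq R))) :=
  Polynomial.map_injective _ amap_inj

/-- clearing denominators -/
theorem clear (p : PK R) : ∃ c : R, c ≠ 0 ∧ ∃ P : R[X],
    P.map (algebraMap R (Kq R)) = cpoly R c * p := by
  obtain ⟨b, hb, h⟩ := IsLocalization.integerNormalization_spec (nonZeroDivisors R) p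
  refine ⟨b, nonZeroDivisors.ne_zero hb, _, h.trans ?_⟩
  rw [cpoly, ← Polynomial.smul_eq_C_mul]
  ext n
  simp [Algebra.smul_def]

theorem dvd_C {r : R} (hr : r ≠ 0) {P : R[X]} (h : P ∣ Polynomial.C r) :
    ∃ c : R, c ≠ 0 ∧ P = Polynomial.C c := by
  obtain ⟨Q, hQ⟩ := h
  have hn : P * Q ≠ 0 := by rw [← hQ]; simpa using hr
  have := congrArg Polynomial.natDegree hQ
  rw [Polynomial.natDegree_C, Polynomial.natDegree_mul (left_ne_zero_of_mul hn)
    (right_ne_zero_of_mul hn)] at this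
  have e := Polynomial.eq_C_of_natDegree_eq_zero (p := P) (by omega)
  refine ⟨P.coeff 0, ?_, e⟩
  intro h0
  rw [h0, Polynomial.C_0] at e
  exact left_ne_zero_of_mul hn e

theorem map_C' (r : R) : (Polynomial.C r).map (algebraMap R (Kq R)) = cpoly R r := by
  simp [cpoly]

theorem cpoly_unit {r : R} (h : r ≠ 0) : IsUnit (cpoly R r) := by
  rw [cpoly, Polynomial.isUnit_C, isUnit_iff_ne_zero]
  intro h0
  exact h (amap_inj (by rw [h0, map_zero]))

theorem scale_dvd' {A P : R[X]} (hP : P ≠ 0)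
    (hh : A.map (algebraMap R (Kq R)) ∣ P.map (algebraMap R (Kq R))) :
    ∃ Q : R[X], Q ∣ P ∧ ∃ γ : R, γ ≠ 0 ∧ A = Polynomial.C γ * Q := by
  obtain ⟨q, hq⟩ := hh
  obtain ⟨e, e0, B, hB⟩ := clear q
  have : A * B = Polynomial.C e * P := by
    apply pmap_inj
    rw [Polynomial.map_mul, Polynomial.map_mul, hB, map_C', hq]; ring
  obtain ⟨G, Q, hG, hQ, rfl⟩ := exists_dvd_and_dvd_of_dvd_mul (Dvd.intro B this)
  obtain ⟨γ, γ0, rfl⟩ := dvd_C e0 hG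
  exact ⟨Q, hQ, γ, γ0, rfl⟩

theorem assoc_cpoly {c : R} (c0 : c ≠ 0) (p : PK R) : Associated (cpoly R c * p) p :=
  associated_unit_mul_left p _ (cpoly_unit c0)

/-- a divisor of `f` over `K` is up to constants a divisor over `R`. -/
theorem scale_dvd {h : PK R} {P : R[X]} (hP : P ≠ 0) (hh : h ∣ P.map (algebraMap R (Kq R))) :
    ∃ Q : R[X], Q ∣ P ∧ Associated (Q.map (algebraMap R (Kq R))) h := by
  obtain ⟨c, c0, A, hA⟩ := clear h
  have hh2 : A.map (algebraMap R (Kq R)) ∣ P.map (algebraMap R (Kq R)) := by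
    rw [hA]; exact (assoc_cpoly c0 h).dvd.trans hh
  obtain ⟨Q, hQ, γ, γ0, rfl⟩ := scale_dvd' hP hh2
  refine ⟨Q, hQ, ?_⟩
  rw [Polynomial.map_mul, map_C'] at hA
  have a1 := assoc_cpoly γ0 (Q.map (algebraMap R (Kq R)))
  rw [hA] at a1
  exact a1.symm.trans (assoc_cpoly c0 h)

theorem relprime {f g : PK R} (hf : f ∈ rxSet R) (hf0 : f ≠ 0) (hg : g ∈ rxSet R) (hg0 : g ≠ 0)
    (hcop1 : ∀ h : PK R, h ∈ rxSet R → (∃ q ∈ rxSet R, f = h * q) →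
      (∃ q ∈ rxSet R, g = h * q) → IsMUnit (rxnz R) h) : IsRelPrime f g := by
  obtain ⟨f, rfl⟩ := rx_lift hf
  obtain ⟨g, rfl⟩ := rx_lift hg
  intro h h1 h2
  have f0 : f ≠ 0 := by rintro rfl; simp at hf0
  have g0 : g ≠ 0 := by rintro rfl; simp at hg0
  obtain ⟨Q, hQ, a1⟩ := scale_dvd f0 h1
  have h3 := a1.dvd.trans h2
  obtain ⟨Q', ⟨T, hT⟩, γ, γ0, rfl⟩ := scale_dvd' g0 h3
  obtain ⟨S, hS⟩ := hQ
  obtain ⟨⟨-, m0⟩, v, -, hv⟩ := hcop1 (Q'.map (algebraMap R (Kq R))) (map_rx _)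
    ⟨(Polynomial.C γ * S).map (algebraMap R (Kq R)), map_rx _, by
      rw [← Polynomial.map_mul, hS]; congr 1; ring⟩
    ⟨T.map (algebraMap R (Kq R)), map_rx _, by rw [← Polynomial.map_mul, hT]⟩
  rw [Polynomial.map_mul, map_C'] at a1
  exact a1.isUnit ((cpoly_unit γ0).mul (IsUnit.of_mul_eq_one _ hv))

theorem mon_of_dvd {f p q : PK R} {k : ℕ} (hp : p ∈ intSet R) (hq : q ∈ intSet R) (hf0 : f ≠ 0)
    (h : p * q = f ^ k) : p ∈ mon R f :=
  ⟨hp, left_ne_zero_of_mul (by rw [h]; exact pow_ne_zero _ hf0), k, q, hq, h⟩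

/-- `r` divides all values of `p` -/
theorem exists_quot {r : R} (hr : r ≠ 0) {p : PK R} (h : ∀ x : R, ∃ s : R,
    Polynomial.eval (algebraMap R (Kq R) x) p = algebraMap R (Kq R) (r * s)) :
    ∃ q ∈ intSet R, p = cpoly R r * q := by
  have r0 : algebraMap R (Kq R) r ≠ 0 := fun h0 => hr (amap_inj (by rw [h0, map_zero]))
  refine ⟨Polynomial.C (algebraMap R (Kq R) r)⁻¹ * p, ?_, ?_⟩
  · intro x
    obtain ⟨s, hs⟩ := h x
    refine ⟨s, ?_⟩
    rw [Polynomial.eval_mul, Polynomial.eval_C, hs, map_mul]; field_simp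
  · rw [cpoly, ← mul_assoc, ← Polynomial.C_mul, mul_inv_cancel₀ r0]; simp

theorem dvd_d {d : PK R → R} (hd : IsImageGcdFun R d) {r : R} {p q : PK R} (hp0 : p ≠ 0)
    (hp : p ∈ intSet R) (hq : q ∈ intSet R) (e : p = cpoly R r * q) : r ∣ d p := by
  refine (hd p hp hp0).2 r fun x => ?_
  obtain ⟨s, hs⟩ := hq x
  exact ⟨s, by rw [e, Polynomial.eval_mul, hs, cpoly, Polynomial.eval_C, map_mul]⟩

theorem d_ne [Infinite R] {d : PK R → R} (hd : IsImageGcdFun R d) {p : PK R} (hp0 : p ≠ 0)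
    (hp : p ∈ intSet R) : d p ≠ 0 := by
  intro h0
  apply hp0
  apply Polynomial.eq_zero_of_infinite_isRoot
  apply (Set.infinite_range_of_injective (amap_inj (R := R))).mono
  rintro _ ⟨x, rfl⟩
  obtain ⟨r, hr⟩ := (hd p hp hp0).1 x
  simp [Polynomial.IsRoot, hr, h0]

theorem d_cmul {d : PK R → R} (hd : IsImageGcdFun R d) {p : PK R} (hp0 : p ≠ 0)
    (hp : p ∈ intSet R) {m : R} (hm : m ≠ 0) : d (cpoly R m * p) ∣ m * d p := by
  have mp0 : cpoly R m * p ≠ 0 := mul_ne_zero (cpoly_ne hm) hp0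
  have mpI := intSet_mul R (cpoly_int m) hp
  obtain ⟨t, ht⟩ := dvd_d hd mp0 mpI hp rfl
  rw [ht]
  apply mul_dvd_mul_left
  refine (hd p hp hp0).2 t fun x => ?_
  obtain ⟨r, hr⟩ := (hd _ mpI mp0).1 x
  refine ⟨r, ?_⟩
  have m0 : algebraMap R (Kq R) m ≠ 0 := fun h0 => hm (amap_inj (by rw [h0, map_zero]))
  rw [Polynomial.eval_mul, cpoly, Polynomial.eval_C, ← cpoly, ht, mul_assoc, map_mul] at hr
  exact mul_left_cancel₀ m0 hr

theorem split_inf [Infinite R] {d : PK R → R} (hd : IsImageGcdFun R d)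
    {f g : PK R} (hf : f ∈ rxSet R) (hf0 : f ≠ 0) (hg : g ∈ rxSet R) (hg0 : g ≠ 0)
    (hmult : ∀ p ∈ mon R f, ∀ q ∈ mon R g, Associated (d (p * q)) (d p * d q))
    {y : PK R} (hy : y ∈ mon R (f * g)) : ∃ r ∈ mon R f, ∃ s ∈ mon R g, y = r * s := by
  obtain ⟨f, rfl⟩ := rx_lift hf
  obtain ⟨g, rfl⟩ := rx_lift hg
  obtain ⟨hyI, hy0, k, z, hzI, e⟩ := hy
  obtain ⟨c, c0, Y, hY⟩ := clear y
  have f0 : f ≠ 0 := by rintro rfl; simp at hf0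
  have g0 : g ≠ 0 := by rintro rfl; simp at hg0
  obtain ⟨W, hW, aW⟩ := scale_dvd (P := (f * g) ^ k) (pow_ne_zero _ (mul_ne_zero f0 g0))
    (h := y) ⟨z, by rw [e]; simp⟩
  rw [mul_pow] at hW
  obtain ⟨Y1, Y2, ⟨T1, hT1⟩, ⟨T2, hT2⟩, rfl⟩ := exists_dvd_and_dvd_of_dvd_mul hW
  set φ := Polynomial.map (algebraMap R (Kq R)) with hφ
  have m1 : φ Y1 ∈ mon R (φ f) := mon_of_dvd (q := φ T1) (k := k) (map_int _) (map_int _) hf0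
    (by simp only [hφ]; rw [← Polynomial.map_mul, ← hT1, Polynomial.map_pow])
  have m2 : φ Y2 ∈ mon R (φ g) := mon_of_dvd (q := φ T2) (k := k) (map_int _) (map_int _) hg0
    (by simp only [hφ]; rw [← Polynomial.map_mul, ← hT2, Polynomial.map_pow])
  obtain ⟨u, hu⟩ := aW
  obtain ⟨κ, hκ, hκu⟩ := Polynomial.isUnit_iff.1 u.isUnit
  obtain ⟨m, n, hn, rfl⟩ := IsFractionRing.div_surjective (A := R) κ
  have n0 : n ≠ 0 := nonZeroDivisors.ne_zero hn
  have n0' : algebraMap R (Kq R) n ≠ 0 := fun h0 => n0 (amap_inj (by rw [h0, map_zero]))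
  -- n y = m Y1 Y2
  have ey : cpoly R n * y = cpoly R m * (φ Y1 * φ Y2) := by
    rw [← hu, ← hκu]
    simp only [hφ, Polynomial.map_mul, cpoly]
    have : Polynomial.C (algebraMap R (Kq R) m) = Polynomial.C (algebraMap R (Kq R) n) *
        Polynomial.C (algebraMap R (Kq R) m / algebraMap R (Kq R) n) := by
      rw [← Polynomial.C_mul]; congr 1; field_simp
    rw [this]; ring
  obtain ⟨r1, hr1, er1⟩ := exists_quot (d_ne hd m1.2.1 m1.1) (hd _ m1.1 m1.2.1).1
  obtain ⟨s1, hs1, es1⟩ := exists_quot (d_ne hd m2.2.1 m2.1) (hd _ m2.1 m2.2.1).1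
  have m12 : φ Y1 * φ Y2 ∈ intSet R := intSet_mul R m1.1 m2.1
  have hdd := hd _ m12 (mul_ne_zero m1.2.1 m2.2.1)
  -- n divides m d(Y1) d(Y2)
  have hm0 : m ≠ 0 := by
    rintro rfl
    have : cpoly R n * y ≠ 0 := mul_ne_zero (cpoly_ne n0) hy0
    rw [ey] at this
    simp [cpoly] at this
  have hdiv : n ∣ m * (d (φ Y1) * d (φ Y2)) := by
    have h1 : n ∣ d (cpoly R m * (φ Y1 * φ Y2)) := by
      refine dvd_d hd ?_ (intSet_mul R (cpoly_int m) m12) hyI ey.symm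
      exact mul_ne_zero (cpoly_ne hm0) (mul_ne_zero m1.2.1 m2.2.1)
    have h2 := h1.trans (d_cmul hd (mul_ne_zero m1.2.1 m2.2.1) m12 hm0)
    exact h2.trans (mul_dvd_mul_left m (hmult _ m1 _ m2).dvd)
  obtain ⟨δ, hδ⟩ := hdiv
  have ey2 : y = cpoly R δ * (r1 * s1) := by
    apply mul_left_cancel₀ (cpoly_ne n0)
    rw [ey, ← mul_assoc (cpoly R n), ← cpoly_mul, ← hδ, cpoly_mul, cpoly_mul]
    calc cpoly R m * (φ Y1 * φ Y2) =
        cpoly R m * ((cpoly R (d (φ Y1)) * r1) * (cpoly R (d (φ Y2)) * s1)) := by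
          rw [← er1, ← es1]
      _ = _ := by ring
  have δ0 : δ ≠ 0 := by
    rintro rfl
    apply hy0
    rw [ey2]; simp [cpoly]
  have fk : φ f ^ k ∈ mon R (φ f) := mon_of_dvd (q := 1) (k := k) (int_pow (map_int _) k)
    (intSet_one R) hf0 (mul_one _)
  have gk : φ g ^ k ∈ mon R (φ g) := mon_of_dvd (q := 1) (k := k) (int_pow (map_int _) k)
    (intSet_one R) hg0 (mul_one _)
  have hδd : δ ∣ d (φ f ^ k) * d (φ g ^ k) := by
    refine (dvd_d hd (mul_ne_zero fk.2.1 gk.2.1) (intSet_mul R fk.1 gk.1)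
      (q := r1 * s1 * z) (intSet_mul R (intSet_mul R hr1 hs1) hzI) ?_).trans (hmult _ fk _ gk).dvd
    rw [← mul_pow, ← e, ey2]; ring
  have split : ∀ (F : PK R) (F0 : F ≠ 0) (FI : F ∈ intSet R) (δ1 : R), δ1 ∣ d (F ^ k) → δ1 ≠ 0 →
      cpoly R δ1 ∈ mon R F := by
    intro F F0 FI δ1 hδ1 hδ0
    obtain ⟨q, hq, eq⟩ := exists_quot (r := δ1) hδ0 (p := F ^ k) (by
      intro x
      obtain ⟨s, hs⟩ := (hd _ (int_pow FI k) (pow_ne_zero _ F0)).1 x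
      obtain ⟨t, ht⟩ := hδ1
      exact ⟨t * s, by rw [hs, ht, mul_assoc]⟩)
    exact mon_of_dvd (cpoly_int _) hq F0 eq.symm
  obtain ⟨δ1, δ2, h1, h2, rfl⟩ := exists_dvd_and_dvd_of_dvd_mul hδd
  refine ⟨cpoly R δ1 * r1, mon_mul R (split _ hf0 (map_int _) _ h1 (left_ne_zero_of_mul δ0)) ?_,
    cpoly R δ2 * s1, mon_mul R (split _ hg0 (map_int _) _ h2 (right_ne_zero_of_mul δ0)) ?_, ?_⟩
  · refine mon_of_dvd (q := cpoly R (d (φ Y1)) * φ T1) (k := k) hr1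
      (intSet_mul R (cpoly_int _) (map_int _)) hf0 ?_
    calc r1 * (cpoly R (d (φ Y1)) * φ T1) = (cpoly R (d (φ Y1)) * r1) * φ T1 := by ring
      _ = φ Y1 * φ T1 := by rw [← er1]
      _ = _ := by simp only [hφ]; rw [← Polynomial.map_mul, ← hT1, Polynomial.map_pow]
  · refine mon_of_dvd (q := cpoly R (d (φ Y2)) * φ T2) (k := k) hs1
      (intSet_mul R (cpoly_int _) (map_int _)) hg0 ?_
    calc s1 * (cpoly R (d (φ Y2)) * φ T2) = (cpoly R (d (φ Y2)) * s1) * φ T2 := by ring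
      _ = φ Y2 * φ T2 := by rw [← es1]
      _ = _ := by simp only [hφ]; rw [← Polynomial.map_mul, ← hT2, Polynomial.map_pow]
  · rw [ey2, cpoly_mul]; ring

theorem split_fin [Finite R] {f g : PK R} (hf0 : f ≠ 0) (hg0 : g ≠ 0)
    {y : PK R} (hy : y ∈ mon R (f * g)) : ∃ r ∈ mon R f, ∃ s ∈ mon R g, y = r * s := by
  have hall : ∀ p : PK R, p ∈ intSet R := by
    intro p x
    obtain ⟨r, hr⟩ := (IsFractionRing.surjective_iff_isField (R := R) (K := Kq R)).2
      (Finite.isField_of_domain R) (Polynomial.eval (algebraMap R (Kq R) x) p)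
    exact ⟨r, hr.symm⟩
  obtain ⟨hyI, hy0, k, z, hzI, e⟩ := hy
  rw [mul_pow] at e
  obtain ⟨r, s, ⟨r', hr⟩, ⟨s', hs⟩, rfl⟩ := exists_dvd_and_dvd_of_dvd_mul (Dvd.intro z e)
  exact ⟨r, mon_of_dvd (hall _) (hall _) hf0 hr.symm, s, mon_of_dvd (hall _) (hall _) hg0 hs.symm, rfl⟩

theorem unit_mon {f : PK R} (hf0 : f ≠ 0) {u : R} (hu : IsUnit u) : cpoly R u ∈ mon R f := by
  obtain ⟨v, hv⟩ := hu.exists_right_inv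
  refine mon_of_dvd (q := cpoly R v) (k := 0) (cpoly_int _) (cpoly_int _) hf0 ?_
  rw [← cpoly_mul, hv]; simp [cpoly]

theorem mon_dvd_eval {f p : PK R} (a : R) {fa : R}
    (hfa : Polynomial.eval (algebraMap R (Kq R) a) f = algebraMap R (Kq R) fa)
    (hp : p ∈ mon R f) : ∃ pa : R,
      Polynomial.eval (algebraMap R (Kq R) a) p = algebraMap R (Kq R) pa ∧ ∃ k, pa ∣ fa ^ k := by
  obtain ⟨hI, -, k, q, hq, e⟩ := hp
  obtain ⟨pa, h1⟩ := hI a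
  obtain ⟨qa, h2⟩ := hq a
  refine ⟨pa, h1, k, qa, amap_inj ?_⟩
  rw [map_pow, ← hfa, ← Polynomial.eval_pow, ← e, Polynomial.eval_mul, h1, h2, map_mul]

theorem inter_aux {f g : PK R} (a : R) {fa ga : R}
    (hfa : Polynomial.eval (algebraMap R (Kq R) a) f = algebraMap R (Kq R) fa)
    (hga : Polynomial.eval (algebraMap R (Kq R) a) g = algebraMap R (Kq R) ga)
    (hab : IsRelPrime fa ga) {r r' s s' : PK R} (hr : r ∈ mon R f) (hr' : r' ∈ mon R f)
    (hs : s ∈ mon R g) (hs' : s' ∈ mon R g) {u v : R} (huv : IsRelPrime u v)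
    (e1 : cpoly R v * r' = cpoly R u * r) (e2 : cpoly R v * s' = cpoly R u * s) : IsUnit u := by
  have aux : ∀ {F p p' : PK R} {Fa : R}
      (_ : Polynomial.eval (algebraMap R (Kq R) a) F = algebraMap R (Kq R) Fa)
      (_ : p ∈ mon R F) (_ : p' ∈ mon R F) (_ : cpoly R v * p' = cpoly R u * p),
      ∃ k, u ∣ Fa ^ k := by
    intro F p p' Fa h h1 h2 h3
    obtain ⟨pa, g1, -⟩ := mon_dvd_eval a h h1
    obtain ⟨pa', g2, k, hk⟩ := mon_dvd_eval a h h2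
    have := congrArg (Polynomial.eval (algebraMap R (Kq R) a)) h3
    rw [Polynomial.eval_mul, Polynomial.eval_mul, g1, g2, cpoly, cpoly, Polynomial.eval_C,
      Polynomial.eval_C, ← map_mul, ← map_mul] at this
    exact ⟨k, (huv.dvd_of_dvd_mul_left (Dvd.intro _ (amap_inj this).symm)).trans hk⟩
  obtain ⟨k, hk⟩ := aux hfa hr hr' e1
  obtain ⟨l, hl⟩ := aux hga hs hs' e2
  exact (hab.pow (m := k) (n := l)) hk hl

theorem inter {f g : PK R} (hf0 : f ≠ 0) (hg0 : g ≠ 0) (hrel : IsRelPrime f g) (a : R) {fa ga : R}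
    (hfa : Polynomial.eval (algebraMap R (Kq R) a) f = algebraMap R (Kq R) fa)
    (hga : Polynomial.eval (algebraMap R (Kq R) a) g = algebraMap R (Kq R) ga)
    (hab : IsRelPrime fa ga) {r r' s s' : PK R} (hr : r ∈ mon R f) (hr' : r' ∈ mon R f)
    (hs : s ∈ mon R g) (hs' : s' ∈ mon R g) (e : r * s' = s * r') :
    ∃ c, c ∈ mon R f ∧ c ∈ mon R g ∧ r = c * r' := by
  have rel : ∀ {p q : PK R}, p ∈ mon R f → q ∈ mon R g → IsRelPrime p q := by
    rintro p q ⟨-, -, k, w, -, hw⟩ ⟨-, -, l, w', -, hw'⟩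
    exact ((hrel.pow (m := k) (n := l)).of_dvd_left (Dvd.intro _ hw)).of_dvd_right (Dvd.intro _ hw')
  have d1 : r ∣ r' := (rel hr hs).dvd_of_dvd_mul_left (Dvd.intro _ e)
  have d2 : r' ∣ r := (rel hr' hs').dvd_of_dvd_mul_right (Dvd.intro_left _ e.symm)
  obtain ⟨w, hw⟩ := associated_of_dvd_dvd d1 d2
  obtain ⟨κ, hκ, hκu⟩ := Polynomial.isUnit_iff.1 w.isUnit
  obtain ⟨u, v, huv, rfl⟩ := IsFractionRing.exists_reduced_fraction (A := R) κ
  have hC : cpoly R u = cpoly R v * w := by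
    rw [← hκu, cpoly, cpoly, ← Polynomial.C_mul, IsLocalization.mk'_spec']
  have e1 : cpoly R v * r' = cpoly R u * r := by rw [hC, ← hw]; ring
  have e3 : s' = s * w := by
    apply mul_left_cancel₀ hr.2.1
    rw [e, ← hw]; ring
  have e2 : cpoly R v * s' = cpoly R u * s := by rw [hC, e3]; ring
  have U1 := inter_aux a hfa hga hab hr hr' hs hs' huv e1 e2
  have U2 := inter_aux a hfa hga hab hr' hr hs' hs huv.symm e1.symm e2.symm
  obtain ⟨t, ht⟩ := U1.exists_right_inv
  have ht1 : IsUnit t := IsUnit.of_mul_eq_one u (by rw [mul_comm, ht])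
  refine ⟨cpoly R (v * t), unit_mon hf0 (U2.mul ht1), unit_mon hg0 (U2.mul ht1), ?_⟩
  have h1 : cpoly R u * cpoly R t = 1 := by rw [← cpoly_mul, ht]; simp [cpoly]
  rw [cpoly_mul, mul_right_comm, e1, mul_right_comm, h1, one_mul]

theorem spl (d : PK R → R) (hd : IsImageGcdFun R d) (a : R)
    (f g : PK R) (hf : f ∈ rxSet R) (hf0 : f ≠ 0) (hg : g ∈ rxSet R) (hg0 : g ≠ 0)
    (hcop1 : ∀ h : PK R, h ∈ rxSet R → (∃ q ∈ rxSet R, f = h * q) →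
      (∃ q ∈ rxSet R, g = h * q) → IsMUnit (rxnz R) h)
    (hcop2 : ∀ r : R,
      (∃ s : R, Polynomial.eval (algebraMap R (Kq R) a) f = algebraMap R (Kq R) (r * s)) →
      (∃ s : R, Polynomial.eval (algebraMap R (Kq R) a) g = algebraMap R (Kq R) (r * s)) →
      IsUnit r)
    (hmult : ∀ p ∈ mon R f, ∀ q ∈ mon R g, Associated (d (p * q)) (d p * d q)) :
    Spl (Hmon R (f * g)) (Hmon R f) (Hmon R g) := by
  have hfI : f ∈ intSet R := by obtain ⟨P, rfl⟩ := rx_lift hf; exact map_int P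
  have hgI : g ∈ intSet R := by obtain ⟨P, rfl⟩ := rx_lift hg; exact map_int P
  obtain ⟨fa, hfa⟩ := hfI a
  obtain ⟨ga, hga⟩ := hgI a
  have hab : IsRelPrime fa ga := by
    rintro r ⟨s, hs⟩ ⟨t, ht⟩
    exact hcop2 r ⟨s, by rw [hfa, hs]⟩ ⟨t, by rw [hga, ht]⟩
  have hrel := relprime hf hf0 hg hg0 hcop1
  have hinj : Function.Injective (algebraMap (PK R) (FF R)) := IsFractionRing.injective _ _
  have zz : ∀ f : PK R, (0 : FF R) ∉ Hmon R f := by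
    rintro f ⟨p, hp, h⟩
    exact hp.2.1 (hinj (by rw [h, map_zero]))
  have hint : ∀ x, Qt (Hmon R f) x → Qt (Hmon R g) x → x ∈ Hmon R f ∧ x ∈ Hmon R g := by
    rintro _ ⟨_, ⟨r, hr, rfl⟩, _, ⟨r', hr', rfl⟩, rfl⟩ ⟨_, ⟨s, hs, rfl⟩, _, ⟨s', hs', rfl⟩, e⟩
    have n1 : algebraMap (PK R) (FF R) r' ≠ 0 := nz (zz f) ⟨r', hr', rfl⟩
    have n2 : algebraMap (PK R) (FF R) s' ≠ 0 := nz (zz g) ⟨s', hs', rfl⟩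
    rw [div_eq_div_iff n1 n2, ← map_mul, ← map_mul] at e
    obtain ⟨c, h1, h2, rfl⟩ := inter hf0 hg0 hrel a hfa hga hab hr hr' hs hs' (hinj e)
    rw [map_mul, mul_div_cancel_right₀ _ n1]
    exact ⟨⟨c, h1, rfl⟩, ⟨c, h2, rfl⟩⟩
  refine ⟨zz f, zz g, ?_, fun x h1 h2 => (hint x h1 h2).1, fun x h1 h2 => (hint x h1 h2).2⟩
  apply Set.Subset.antisymm
  · rintro _ ⟨_, ⟨r, ⟨hr, r0, k, p, hp, e⟩, rfl⟩, _, ⟨s, ⟨hs, s0, l, q, hq, e'⟩, rfl⟩, rfl⟩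
    refine ⟨r * s, mon_of_dvd (q := p * q * (f ^ l * g ^ k)) (k := k + l) (intSet_mul R hr hs)
      (intSet_mul R (intSet_mul R hp hq) (intSet_mul R (int_pow hfI _) (int_pow hgI _)))
      (mul_ne_zero hf0 hg0) ?_, map_mul _ _ _⟩
    calc r * s * (p * q * (f ^ l * g ^ k)) = (r * p) * (s * q) * (f ^ l * g ^ k) := by ring
      _ = _ := by rw [e, e']; ring
  · rintro _ ⟨y, hy, rfl⟩
    have : ∃ r ∈ mon R f, ∃ s ∈ mon R g, y = r * s := by
      rcases finite_or_infinite R with h | h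
      · exact split_fin hf0 hg0 hy
      · exact split_inf hd hf hf0 hg hg0 hmult hy
    obtain ⟨r, hr, s, hs, rfl⟩ := this
    exact ⟨_, ⟨r, hr, rfl⟩, _, ⟨s, hs, rfl⟩, (map_mul _ _ _).symm⟩

end Poly

end IVP18

open IVP Pointwise Polynomial
/-- Proposition `twoproduct1`. -/
theorem stmt_18 (R : Type*) [CommRing R] [IsDomain R] [UniqueFactorizationMonoid R]
    (d : PK R → R) (hd : IsImageGcdFun R d) (a : R)
    (f g : PK R) (hf : f ∈ rxSet R) (hf0 : f ≠ 0) (hg : g ∈ rxSet R) (hg0 : g ≠ 0)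
    (hcop1 : ∀ h : PK R, h ∈ rxSet R → (∃ q ∈ rxSet R, f = h * q) →
      (∃ q ∈ rxSet R, g = h * q) → IsMUnit (rxnz R) h)
    (hcop2 : ∀ r : R,
      (∃ s : R, Polynomial.eval (algebraMap R (Kq R) a) f = algebraMap R (Kq R) (r * s)) →
      (∃ s : R, Polynomial.eval (algebraMap R (Kq R) a) g = algebraMap R (Kq R) (r * s)) →
      IsUnit r)
    (hmult : ∀ p ∈ mon R f, ∀ q ∈ mon R g, Associated (d (p * q)) (d p * d q)) :
    Nonempty (ClassGrp (Hmon R (f * g)) ≃*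
      ClassGrp (Hmon R f) × ClassGrp (Hmon R g)) := by
  exact (IVP18.spl d hd a f g hf hf0 hg hg0 hcop1 hcop2 hmult).iso
end
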